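/- Let q be a prime power, let F_q be the finite field with q elements, and let k be a positive divisor of q-1 with k ≥ 2. Let f(x) = ax² + bx + c be a quadratic polynomial in F_q[x] (so a ≠ 0) with b² - 4ac ≠ 0. If q > max{e^{e³}, (2k)⁶}, then there exists a primitive element g of F_q such that f(g) ∈ F_q^{×k}. -/

import Mathlib

open scoped Classical

/-- `g` is a primitive element of the finite field `F`, i.e. a generator of `Fˣ`. -/
def IsPrimitiveElement {F : Type*} [Field F] [Fintype F] (g : F) : Prop :=
  ∀ y : F, y ≠ 0 → ∃ n : ℕ, g ^ n = y

/-- `x` is `t`-free: `x ≠ 0` and `x = y ^ d` with `d ∣ t`, `d > 0` forces `d = 1`. -/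
def IsTFree {F : Type*} [Field F] (t : ℕ) (x : F) : Prop :=
  x ≠ 0 ∧ ∀ d : ℕ, 0 < d → d ∣ t → (∃ y : F, y ^ d = x) → d = 1

/-- `N(t, k)`: the number of `t`-free `x ∈ F` with `f(x) = a x² + b x + c` a nonzero
`k`-th power. -/
noncomputable def Ncount (F : Type*) [Field F] [Fintype F] (a b c : F) (t k : ℕ) : ℕ :=
  Nat.card {x : F | IsTFree t x ∧ ∃ y : F, y ≠ 0 ∧ y ^ k = a * x ^ 2 + b * x + c}

/-- `W(n)`: the number of squarefree positive divisors of `n`. -/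
noncomputable def Wnum (n : ℕ) : ℕ := (n.divisors.filter Squarefree).card

/-- `Rad(n)`: the product of the distinct primes dividing `n`. -/
noncomputable def rad (n : ℕ) : ℕ := ∏ p ∈ n.primeFactors, p

open Polynomial

/-- Polynomials all of whose exponents are congruent modulo `R` to some `r < E`. -/
def lacunary (A : Type*) [Field A] (R E : ℕ) : Submodule A A[X] where
  carrier := {P | ∀ n, E ≤ n % R → P.coeff n = 0}
  add_mem' := by
    intro P Q hP hQ n hn
    simp [hP n hn, hQ n hn]
  zero_mem' := by intro n _; simp
  smul_mem' := by
    intro a P hP n hn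
    simp [hP n hn]

theorem mul_expand_mem_lacunary {A : Type*} [Field A] {R E : ℕ} (hER : E ≤ R)
    {P : A[X]} (hP : P.degree < E) (Q : A[X]) : P * expand A R Q ∈ lacunary A R E := by
  intro n hn
  rw [coeff_mul]
  refine Finset.sum_eq_zero fun x hx => ?_
  rw [Finset.HasAntidiagonal.mem_antidiagonal] at hx
  by_contra hne
  obtain ⟨h1, h2⟩ := mul_ne_zero_iff.mp hne
  have h3 : x.1 < E := by
    by_contra h
    exact h1 (coeff_eq_zero_of_degree_lt (lt_of_lt_of_le hP (by exact_mod_cast not_lt.mp h)))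
  rw [coeff_expand (by omega)] at h2
  have h4 : R ∣ x.2 := by
    by_contra h
    simp [h] at h2
  obtain ⟨k, hk⟩ := h4
  have : n % R = x.1 := by
    rw [← hx, hk, Nat.add_mul_mod_self_left, Nat.mod_eq_of_lt (by omega)]
  omega

theorem taylor_mem_lacunary {A : Type*} [Field A] {p : ℕ} [CharP A p] [Fact p.Prime] {e E : ℕ}
    (hER : E ≤ p ^ e) {P : A[X]} (hP : P ∈ lacunary A (p ^ e) E) (r : A) :
    taylor r P ∈ lacunary A (p ^ e) E := by
  have hpos : 0 < p ^ e := pow_pos (Fact.out : p.Prime).pos e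
  rw [P.as_sum_support, map_sum]
  refine Submodule.sum_mem _ fun n hn => ?_
  have hn' : n % p ^ e < E := by
    by_contra h
    exact (mem_support_iff.mp hn) (hP n (not_lt.mp h))
  have : taylor r (monomial n (P.coeff n)) = P.coeff n •
      ((X + C r) ^ (n % p ^ e) * expand A (p ^ e) ((X + C (r ^ p ^ e)) ^ (n / p ^ e))) := by
    rw [taylor_monomial, smul_eq_C_mul]
    congr 1
    conv_lhs => rw [← Nat.mod_add_div n (p ^ e), pow_add, pow_mul]
    congr 1
    rw [add_pow_char_pow]
    simp
  rw [this]
  refine Submodule.smul_mem _ _ (mul_expand_mem_lacunary hER ?_ _)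
  rw [degree_pow, degree_X_add_C]
  simpa using hn'

theorem eq_zero_of_sum_lacunary_mul_pow {A : Type*} [Field A] {D E : ℕ} {G : A[X]}
    (hG : G.coeff 0 ≠ 0) (P : Fin D → A[X])
    (hP : ∀ j, P j ∈ lacunary A (D * E + 1) E)
    (h : ∑ j, P j * (X * G) ^ ((j : ℕ) * E) = 0) : ∀ j, P j = 0 := by
  by_contra! hne
  have hG0 : G ≠ 0 := by rintro rfl; simp at hG
  have hXG : ∀ n : ℕ, (X * G) ^ n ≠ 0 := fun n => pow_ne_zero _ (mul_ne_zero X_ne_zero hG0)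
  have hXGt : ∀ n : ℕ, ((X * G) ^ n).natTrailingDegree = n := by
    intro n
    have hGn : (G ^ n).natTrailingDegree = 0 :=
      Nat.le_zero.mp (natTrailingDegree_le_of_ne_zero
        (by simp [coeff_zero_eq_eval_zero] at hG ⊢; simp [hG]))
    rw [mul_pow, natTrailingDegree_mul (pow_ne_zero _ X_ne_zero) (pow_ne_zero _ hG0), hGn]
    simp
  set ν : Fin D → ℕ := fun j => (P j).natTrailingDegree + j * E with hν
  have hνt : ∀ j, P j ≠ 0 → (P j * (X * G) ^ ((j : ℕ) * E)).natTrailingDegree = ν j := by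
    intro j hj
    rw [natTrailingDegree_mul hj (hXG _), hXGt]
  obtain ⟨j₀, hj₀, hmin⟩ := Finset.exists_min_image
    (Finset.univ.filter fun j => P j ≠ 0) ν (by
      obtain ⟨j, hj⟩ := hne
      exact ⟨j, by simpa using hj⟩)
  simp only [Finset.mem_filter, Finset.mem_univ, true_and] at hj₀ hmin
  have hmod : ∀ j, P j ≠ 0 → ∃ r t, r < E ∧ ν j = (r + j * E) + (D * E + 1) * t := by
    intro j hj
    refine ⟨(P j).natTrailingDegree % (D * E + 1), (P j).natTrailingDegree / (D * E + 1), ?_, ?_⟩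
    · by_contra hlt
      have := hP j _ (not_lt.mp hlt)
      rw [← trailingCoeff, trailingCoeff_eq_zero] at this
      exact hj this
    · have := Nat.mod_add_div (P j).natTrailingDegree (D * E + 1)
      simp only [hν]
      omega
  have hbound : ∀ (j : Fin D) (r : ℕ), r < E → r + j * E < D * E + 1 := by
    intro j r hr
    have : ((j : ℕ) + 1) * E ≤ D * E := Nat.mul_le_mul_right _ j.2
    nlinarith
  have hinj : ∀ j, P j ≠ 0 → ν j = ν j₀ → j = j₀ := by
    intro j hj hjj
    obtain ⟨r, t, hr, hrt⟩ := hmod j hj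
    obtain ⟨r', t', hr', hrt'⟩ := hmod j₀ hj₀
    have h1 : (r + j * E) = (r' + j₀ * E) := by
      have := congrArg (· % (D * E + 1)) (hrt.symm.trans (hjj.trans hrt'))
      simpa [Nat.add_mul_mod_self_left, Nat.mod_eq_of_lt (hbound j r hr),
        Nat.mod_eq_of_lt (hbound j₀ r' hr')] using this
    have h2 : (r + j * E) / E = (r' + j₀ * E) / E := by rw [h1]
    rw [Nat.add_mul_div_right _ _ (by omega), Nat.add_mul_div_right _ _ (by omega),
      Nat.div_eq_of_lt hr, Nat.div_eq_of_lt hr'] at h2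
    exact Fin.ext (by omega)
  have hcoeff := congrArg (fun Q : A[X] => Q.coeff (ν j₀)) h
  simp only [finsetSum_coeff, coeff_zero] at hcoeff
  rw [Finset.sum_eq_single j₀] at hcoeff
  · rw [← hνt j₀ hj₀, ← trailingCoeff, trailingCoeff_eq_zero] at hcoeff
    exact mul_ne_zero hj₀ (hXG _) hcoeff
  · intro j _ hj
    by_cases hPj : P j = 0
    · simp [hPj]
    · refine coeff_eq_zero_of_lt_natTrailingDegree ?_
      rw [hνt j hPj]
      exact lt_of_le_of_ne (hmin j hPj) fun heq => hj (hinj j hPj heq.symm)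
  · simp

/-- Stepanov's auxiliary polynomial with coefficient array `c`. -/
noncomputable def stepanovPoly {K : Type*} [Field K] (f : K[X]) (R E : ℕ) {D M l : ℕ}
    (c : Fin D × Fin D × Fin M × Fin l → K) : K[X] :=
  ∑ x, C (c x) * X ^ ((x.2.2.2 : ℕ) + x.2.2.1 * R + x.1 * E) * f ^ ((x.2.1 : ℕ) * E)

theorem expand_stepanovPoly {K : Type*} [Field K] (f : K[X]) {R E D M l : ℕ}
    (hR : R = D * E + 1) (c : Fin D × Fin D × Fin M × Fin l → K) :
    X ^ (D - 1) * expand K D (stepanovPoly f R E c) =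
      ∑ j : Fin D, (∑ y : Fin D × Fin M × Fin l, C (c (y.1, j, y.2.1, y.2.2)) *
        X ^ ((D * y.2.2 + (D - 1 - y.1)) + (D * y.2.1 + y.1) * R)) *
          (expand K D f) ^ ((j : ℕ) * E) := by
  simp only [stepanovPoly, map_sum, Finset.mul_sum, Finset.sum_mul, Fintype.sum_prod_type]
  rw [Finset.sum_comm]
  refine Finset.sum_congr rfl fun j _ => Finset.sum_congr rfl fun i _ =>
    Finset.sum_congr rfl fun t _ => Finset.sum_congr rfl fun s _ => ?_
  simp only [map_mul, map_pow, expand_C, expand_X, ← pow_mul]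
  have : D * s + (D - 1 - i) + (D * t + i) * R = D * (s + t * R + i * E) + (D - 1) := by
    have hi : D - 1 = (D - 1 - i) + i := by omega
    conv_rhs => rw [hi]
    rw [hR]
    ring
  rw [this]
  ring

theorem stepanovPoly_ne_zero {K A : Type*} [Field K] [Field A] [Algebra K A] {p e : ℕ}
    [CharP K p] [Fact p.Prime] (f : K[X]) {E D M l : ℕ} (hE : 0 < E)
    (hR : p ^ e = D * E + 1) (hl : D * l ≤ E) {ζ : A} (hζ : ζ ≠ 0)
    (hf : aeval (ζ ^ D) f = 0) (hf' : aeval (ζ ^ D) (derivative f) ≠ 0)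
    {c : Fin D × Fin D × Fin M × Fin l → K} (hc : c ≠ 0) :
    stepanovPoly f (p ^ e) E c ≠ 0 := by
  have hinj : Function.Injective (algebraMap K A) := (algebraMap K A).injective
  have : CharP A p := charP_of_injective_algebraMap hinj p
  obtain ⟨⟨i₀, j₀, t₀, s₀⟩, hx⟩ := Function.ne_iff.mp hc
  have hD : 0 < D := i₀.pos
  have hDA : (D : A) ≠ 0 := by
    intro h
    rw [CharP.cast_eq_zero_iff A p] at h
    have he : e ≠ 0 := by
      rintro rfl
      have : 0 < D * E := Nat.mul_pos hD hE
      simp at hR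
      omega
    have h1 : p ∣ D * E + 1 := hR ▸ dvd_pow_self p he
    have h2 : p ∣ 1 := (Nat.dvd_add_right (h.mul_right E)).mp h1
    exact (Fact.out : p.Prime).one_lt.ne' (Nat.dvd_one.mp h2)
  intro hzero
  set F : A[X] := (expand K D f).map (algebraMap K A) with hF
  have hroot : F.eval ζ = 0 := by
    rw [hF, eval_map_algebraMap, expand_aeval, hf]
  have hderiv : (derivative F).eval ζ ≠ 0 := by
    rw [hF, derivative_map, eval_map_algebraMap, derivative_expand, map_mul, expand_aeval]
    refine mul_ne_zero hf' ?_
    simp [hDA, hζ]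
  obtain ⟨G, hG⟩ : ∃ G, taylor ζ F = X * G := by
    have : X ∣ taylor ζ F := by
      rw [X_dvd_iff, taylor_coeff_zero, hroot]
    exact this
  have hG0 : G.coeff 0 ≠ 0 := by
    have h1 : (taylor ζ F).coeff 1 = (derivative F).eval ζ := taylor_coeff_one _ _
    rw [hG, coeff_X_mul] at h1
    rwa [h1]
  set P : Fin D → A[X] := fun j => ∑ y : Fin D × Fin M × Fin l,
    C (algebraMap K A (c (y.1, j, y.2.1, y.2.2))) *
        X ^ ((D * y.2.2 + (D - 1 - y.1)) + (D * y.2.1 + y.1) * (p ^ e)) with hPdef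
  have hlt : ∀ (i : Fin D) (s : Fin l), D * (s : ℕ) + (D - 1 - i) < E := by
    intro i s
    have h1 : D * ((s : ℕ) + 1) ≤ D * l := Nat.mul_le_mul_left _ s.2
    have : D * ((s : ℕ) + 1) = D * s + D := by ring
    omega
  have hER : E ≤ p ^ e := by rw [hR]; nlinarith
  have hP : ∀ j, P j ∈ lacunary A (p ^ e) E := by
    intro j
    refine Submodule.sum_mem _ fun y _ => ?_
    intro n hn
    rw [coeff_C_mul, coeff_X_pow, if_neg, mul_zero]
    rintro rfl
    rw [Nat.add_mul_mod_self_right, Nat.mod_eq_of_lt (lt_of_lt_of_le (hlt _ _) hER)] at hn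
    exact absurd (hlt y.1 y.2.2) (not_lt.mpr hn)
  have hsum : ∑ j, P j * F ^ ((j : ℕ) * E) = 0 := by
    have := expand_stepanovPoly f hR c
    rw [hzero, map_zero, mul_zero] at this
    have := congrArg (Polynomial.map (algebraMap K A)) this
    simpa [Polynomial.map_sum, hPdef, hF, Polynomial.map_mul, Polynomial.map_pow] using this.symm
  have hsum' : ∑ j, taylor ζ (P j) * (X * G) ^ ((j : ℕ) * E) = 0 := by
    have := congrArg (taylor ζ) hsum
    simpa [map_sum, taylor_mul, taylor_pow, hG] using this
  have hall := eq_zero_of_sum_lacunary_mul_pow hG0 (fun j => taylor ζ (P j))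
    (fun j => hR ▸ taylor_mem_lacunary hER (hP j) ζ) hsum' j₀
  have hPj : P j₀ = 0 := taylor_injective ζ (by simpa using hall)
  have hco := congrArg
    (coeff · ((D * s₀ + (D - 1 - i₀)) + (D * t₀ + i₀) * (p ^ e))) hPj
  simp only [hPdef, finsetSum_coeff, coeff_C_mul, coeff_X_pow, coeff_zero] at hco
  rw [Finset.sum_eq_single (i₀, t₀, s₀)] at hco
  · simp only [if_true, mul_one] at hco
    rw [map_eq_zero] at hco
    exact hx hco
  · rintro ⟨i, t, s⟩ _ hne
    rw [if_neg, mul_zero]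
    intro heq
    apply hne
    simp only at heq
    have a1 := lt_of_lt_of_le (hlt i s) hER
    have a2 := lt_of_lt_of_le (hlt i₀ s₀) hER
    have h1 : D * (s : ℕ) + (D - 1 - i) = D * s₀ + (D - 1 - i₀) := by
      have := congrArg (· % p ^ e) heq
      simpa [Nat.add_mul_mod_self_right, Nat.mod_eq_of_lt a1, Nat.mod_eq_of_lt a2] using this.symm
    have h2 : D * (t : ℕ) + i = D * t₀ + i₀ := by
      have : (D * (t : ℕ) + i) * p ^ e = (D * t₀ + i₀) * p ^ e := by omega
      exact Nat.eq_of_mul_eq_mul_right (by omega) this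
    have h3 : (i : ℕ) = i₀ := by
      have := congrArg (· % D) h2
      simpa [Nat.mul_add_mod, Nat.mod_eq_of_lt i.2, Nat.mod_eq_of_lt i₀.2] using this
    have h4 : (t : ℕ) = t₀ := Nat.eq_of_mul_eq_mul_left hD (by omega)
    have h5 : (s : ℕ) = s₀ := Nat.eq_of_mul_eq_mul_left hD (by rw [h3] at h1; omega)
    exact Prod.ext (Fin.ext h3) (Prod.ext (Fin.ext h4) (Fin.ext h5))
  · simp

theorem natDegree_stepanovPoly_le {K : Type*} [Field K] {f : K[X]} (hf : f.natDegree ≤ 2)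
    {R E D M l : ℕ} (hR : R = D * E + 1) (c : Fin D × Fin D × Fin M × Fin l → K) :
    (stepanovPoly f R E c).natDegree ≤ l + (M + 3) * R := by
  refine natDegree_sum_le_of_forall_le _ _ fun ⟨i, j, t, s⟩ _ => ?_
  refine natDegree_mul_le.trans ?_
  have h1 := natDegree_C_mul_X_pow_le (c (i, j, t, s)) ((s : ℕ) + t * R + i * E)
  have h2 : (f ^ ((j : ℕ) * E)).natDegree ≤ (j * E) * 2 :=
    natDegree_pow_le.trans (Nat.mul_le_mul_left _ hf)
  have h3 : (t : ℕ) * R ≤ M * R := Nat.mul_le_mul_right _ t.2.le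
  have h4 : (i : ℕ) * E ≤ D * E := Nat.mul_le_mul_right _ i.2.le
  have h5 : (j : ℕ) * E ≤ D * E := Nat.mul_le_mul_right _ j.2.le
  have h6 := s.2
  have h7 : (M + 3) * R = M * R + 3 * R := by ring
  simp only at *
  omega

/-- The polynomial which must vanish for `stepanovPoly f R E c` to vanish on the points where
the relevant norms take the values `u` and `v`. -/
noncomputable def stepanovDual {K : Type*} [Field K] (f : K[X]) (u v : K) (R E : ℕ) {D M l : ℕ}
    (c : Fin D × Fin D × Fin M × Fin l → K) : K[X] :=
  ∑ x, c x • (C (u ^ (x.1 : ℕ) * v ^ (x.2.1 : ℕ)) *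
    X ^ (x.2.2.2 * R + x.2.2.1 + (D - x.1) * E) * f ^ ((D - x.2.1) * E))

theorem natDegree_stepanovDual_lt {K : Type*} [Field K] {f : K[X]} (hf : f.natDegree ≤ 2) (u v : K)
    {R E D M l : ℕ} (hR : R = D * E + 1) (c : Fin D × Fin D × Fin M × Fin l → K) :
    (stepanovDual f u v R E c).natDegree < (l + 3) * R + M := by
  refine Nat.lt_of_le_pred (by rw [hR]; positivity) ?_
  refine natDegree_sum_le_of_forall_le _ _ fun ⟨i, j, t, s⟩ _ => ?_
  refine (natDegree_smul_le _ _).trans (natDegree_mul_le.trans ?_)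
  have h1 := natDegree_C_mul_X_pow_le (u ^ (i : ℕ) * v ^ (j : ℕ)) (s * R + t + (D - i) * E)
  have h2 : (f ^ ((D - j) * E)).natDegree ≤ ((D - j) * E) * 2 :=
    natDegree_pow_le.trans (Nat.mul_le_mul_left _ hf)
  have h3 : (s : ℕ) * R ≤ l * R := Nat.mul_le_mul_right _ s.2.le
  have h4 : (D - i) * E ≤ D * E := Nat.mul_le_mul_right _ (Nat.sub_le _ _)
  have h5 : (D - j) * E ≤ D * E := Nat.mul_le_mul_right _ (Nat.sub_le _ _)
  have h6 := t.2
  have h7 : (l + 3) * R = l * R + 3 * R := by ring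
  simp only [Nat.pred_eq_sub_one] at *
  omega

theorem exists_stepanovDual_eq_zero {K : Type*} [Field K] {f : K[X]} (hf : f.natDegree ≤ 2)
    (u v : K) {R E D M l : ℕ} (hR : R = D * E + 1) (hcount : (l + 3) * R + M < D * D * M * l) :
    ∃ c : Fin D × Fin D × Fin M × Fin l → K, c ≠ 0 ∧ stepanovDual f u v R E c = 0 := by
  let T : (Fin D × Fin D × Fin M × Fin l → K) →ₗ[K] (Fin ((l + 3) * R + M) → K) :=
    { toFun := fun c n => (stepanovDual f u v R E c).coeff n
      map_add' := by
        intro a b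
        ext n
        simp [stepanovDual, add_smul, Finset.sum_add_distrib]
      map_smul' := by
        intro a b
        ext n
        simp [stepanovDual, Finset.mul_sum, mul_assoc] }
  have hker : LinearMap.ker T ≠ ⊥ := by
    refine LinearMap.ker_ne_bot_of_finrank_lt ?_
    simp only [Module.finrank_fintype_fun_eq_card, Fintype.card_prod, Fintype.card_fin]
    calc _ < D * D * M * l := hcount
      _ = _ := by ring
  obtain ⟨c, hc, hc0⟩ := Submodule.exists_mem_ne_zero_of_ne_bot hker
  refine ⟨c, hc0, ?_⟩
  ext n
  by_cases hn : n < (l + 3) * R + M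
  · exact congrFun (LinearMap.mem_ker.mp hc) ⟨n, hn⟩
  · rw [coeff_zero]
    exact coeff_eq_zero_of_natDegree_lt
      (lt_of_lt_of_le (natDegree_stepanovDual_lt hf u v hR c) (not_lt.mp hn))

theorem aeval_stepanovPoly_pow {K L : Type*} [Field K] [Fintype K] [Field L] [Algebra K L]
    (f : K[X]) {m E D M l : ℕ} (hR : Fintype.card K ^ m = D * E + 1)
    {x : L} {u v : K} (hx : x ^ (E * (Fintype.card K ^ m + 1)) = algebraMap K L u)
    (hfx : (aeval x f) ^ (E * (Fintype.card K ^ m + 1)) = algebraMap K L v)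
    (hQ : x ^ (Fintype.card K ^ m * Fintype.card K ^ m) = x)
    (c : Fin D × Fin D × Fin M × Fin l → K) :
    (aeval x (stepanovPoly f (Fintype.card K ^ m) E c)) ^ Fintype.card K ^ m *
      (x ^ (D * E) * (aeval x f) ^ (D * E)) =
    aeval x (stepanovDual f u v (Fintype.card K ^ m) E c) := by
  obtain ⟨p, _⟩ := CharP.exists K
  obtain ⟨a, hp, hcard⟩ := FiniteField.card K p
  have : Fact p.Prime := ⟨hp⟩
  have : CharP L p := charP_of_injective_algebraMap (algebraMap K L).injective p
  have hpow : Fintype.card K ^ m = p ^ (a * m) := by rw [hcard, pow_mul]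
  set R := Fintype.card K ^ m with hRdef
  set w := aeval x f with hw
  simp only [stepanovPoly, stepanovDual, map_sum]
  conv_lhs => rw [hpow, sum_pow_char_pow, ← hpow]
  rw [Finset.sum_mul]
  refine Finset.sum_congr rfl fun ⟨i, j, t, s⟩ _ => ?_
  simp only [map_mul, map_pow, aeval_C, aeval_X, map_smul, ← hw]
  rw [Algebra.smul_def]
  have hc : algebraMap K L (c (i, j, t, s)) ^ R = algebraMap K L (c (i, j, t, s)) := by
    rw [← map_pow, hRdef, FiniteField.pow_card_pow]
  have key : ∀ (y : L) (z : K) (n : ℕ), n < D → y ^ (E * (R + 1)) = algebraMap K L z →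
      (y ^ (n * E)) ^ R * y ^ (D * E) = (algebraMap K L z) ^ n * y ^ ((D - n) * E) := by
    intro y z n hn hy
    rw [← hy, ← pow_mul, ← pow_mul, ← pow_add, ← pow_add]
    congr 1
    obtain ⟨d, rfl⟩ := Nat.exists_eq_add_of_lt hn
    have : n + d + 1 - n = d + 1 := by omega
    rw [this]
    ring
  have kx := key x u i i.2 hx
  have kw := key w v j j.2 hfx
  have ht : (x ^ ((t : ℕ) * R)) ^ R = x ^ (t : ℕ) := by
    rw [← pow_mul, mul_assoc, mul_comm, pow_mul, hQ]
  calc _ = algebraMap K L (c (i, j, t, s)) ^ R * (x ^ (s : ℕ)) ^ R * (x ^ ((t : ℕ) * R)) ^ R *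
        ((x ^ ((i : ℕ) * E)) ^ R * x ^ (D * E)) * ((w ^ ((j : ℕ) * E)) ^ R * w ^ (D * E)) := by
          rw [pow_add, pow_add]; ring
    _ = _ := by
          rw [hc, kx, kw, ht]
          rw [pow_add, pow_add, pow_mul]; ring

theorem card_norm_fibre_le {K L : Type*} [Field K] [Fintype K] [Field L] [Fintype L] [Algebra K L]
    {f : K[X]} (hf : f.natDegree ≤ 2)
    {θ : AlgebraicClosure K} (hθ : θ ≠ 0) (hfθ : aeval θ f = 0) (hf'θ : aeval θ (derivative f) ≠ 0)
    {m E D M l : ℕ} (hm : Module.finrank K L = 2 * m) (hD : D = Fintype.card K - 1)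
    (hE : 0 < E)
    (hR : Fintype.card K ^ m = D * E + 1) (hl : D * l ≤ E)
    (hcount : (l + 3) * Fintype.card K ^ m + M < D * D * M * l)
    {u v : K} (hu : u ≠ 0) (hv : v ≠ 0) :
    (Finset.univ.filter fun x : L =>
      Algebra.norm K x = u ∧ Algebra.norm K (aeval x f) = v).card ≤
        l + (M + 3) * Fintype.card K ^ m := by
  obtain ⟨p, _⟩ := CharP.exists K
  obtain ⟨a, hp, hcard⟩ := FiniteField.card K p
  have : Fact p.Prime := ⟨hp⟩
  have hpow : Fintype.card K ^ m = p ^ (a * m) := by rw [hcard, pow_mul]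
  have hcL : Fintype.card L = Fintype.card K ^ m * Fintype.card K ^ m := by
    rw [Module.card_eq_pow_finrank (K := K), hm]; ring
  have hDpos : 0 < D := by have := Fintype.one_lt_card (α := K); omega
  have hexp : (Nat.card L - 1) / (Nat.card K - 1) = E * (Fintype.card K ^ m + 1) := by
    rw [Nat.card_eq_fintype_card, Nat.card_eq_fintype_card, ← hD, hcL, hR]
    refine Nat.div_eq_of_eq_mul_right hDpos ?_
    have : (D * E + 1) * (D * E + 1) = D * (E * (D * E + 1 + 1)) + 1 := by ring
    omega
  obtain ⟨ζ, hζ⟩ := IsAlgClosed.exists_pow_nat_eq θ hDpos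
  have hζ0 : ζ ≠ 0 := by
    rintro rfl
    rw [zero_pow hDpos.ne'] at hζ
    exact hθ hζ.symm
  obtain ⟨c, hc, hdual⟩ := exists_stepanovDual_eq_zero (M := M) (l := l) hf u v hR hcount
  have hne : stepanovPoly f (Fintype.card K ^ m) E c ≠ 0 := by
    rw [hpow]
    refine stepanovPoly_ne_zero f hE (hpow ▸ hR) hl hζ0 ?_ ?_ hc
    · rwa [hζ]
    · rwa [hζ]
  refine le_trans ?_ (natDegree_stepanovPoly_le hf hR c)
  rw [← natDegree_map (algebraMap K L)]
  have hne' := (Polynomial.map_ne_zero_iff (algebraMap K L).injective).mpr hne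
  refine card_le_degree_of_subset_roots (Z := Finset.univ.filter fun x : L =>
      Algebra.norm K x = u ∧ Algebra.norm K (aeval x f) = v) ?_
  intro x hx
  simp only [Finset.mem_val, Finset.mem_filter, Finset.mem_univ, true_and] at hx
  obtain ⟨hxu, hxv⟩ := hx
  rw [mem_roots hne', IsRoot, eval_map_algebraMap]
  have hx0 : x ≠ 0 := by
    rintro rfl
    exact hu (by rw [← hxu, Algebra.norm_zero])
  have hf0 : aeval x f ≠ 0 := by
    intro h
    exact hv (by rw [← hxv, h, Algebra.norm_zero])
  have hE1 := aeval_stepanovPoly_pow f hR (x := x) (u := u) (v := v)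
    (by rw [← hexp, ← FiniteField.algebraMap_norm_eq_pow, hxu])
    (by rw [← hexp, ← FiniteField.algebraMap_norm_eq_pow, hxv])
    (by rw [← hcL, FiniteField.pow_card]) c
  rw [hdual, map_zero] at hE1
  rcases mul_eq_zero.mp hE1 with h | h
  · exact eq_zero_of_pow_eq_zero h
  · exact absurd h (mul_ne_zero (pow_ne_zero _ hx0) (pow_ne_zero _ hf0))

theorem stepanov_count_lt {D R l q : ℕ} (hD : q = D + 1) (hD2 : 2 ≤ D) (hl : 1 ≤ l)
    (hR : R = q ^ 2 * l) :
    (l + 3) * R + (R / (D * D) + 200) < D * D * (R / (D * D) + 200) * l := by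
  have h1 : R < D * D * (R / (D * D)) + D * D := by
    have := Nat.lt_mul_div_succ R (show 0 < D * D by positivity)
    rwa [Nat.mul_add, Nat.mul_one] at this
  have hMR : R / (D * D) ≤ R := Nat.div_le_self _ _
  generalize R / (D * D) = s at h1 hMR ⊢
  have hDD : 4 ≤ D * D := Nat.mul_le_mul hD2 hD2
  have h4 : R ≤ 4 * (D * D * l) := by
    have : q ^ 2 ≤ 4 * (D * D) := by subst hD; nlinarith
    rw [hR]
    calc q ^ 2 * l ≤ 4 * (D * D) * l := Nat.mul_le_mul_right _ this
      _ = _ := by ring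
  have h5 : 4 ≤ D * D * l := Nat.mul_le_mul hDD hl
  have h6 : R * l ≤ (D * D * s + D * D) * l := Nat.mul_le_mul_right _ h1.le
  have e1 : (l + 3) * R + (s + 200) = R * l + 3 * R + s + 200 := by ring
  have e2 : D * D * (s + 200) * l = (D * D * s + D * D) * l + 199 * (D * D * l) := by ring
  rw [e1, e2]
  omega

theorem card_norm_fibre_le_sq_div {K L : Type*} [Field K] [Fintype K] [Field L] [Fintype L]
    [Algebra K L] (hK : 2 < Fintype.card K) {f : K[X]} (hf : f.natDegree ≤ 2)
    {θ : AlgebraicClosure K} (hθ : θ ≠ 0) (hfθ : aeval θ f = 0) (hf'θ : aeval θ (derivative f) ≠ 0)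
    {m : ℕ} (hm : Module.finrank K L = 2 * (m + 2)) {u v : K} (hu : u ≠ 0) (hv : v ≠ 0) :
    ((Finset.univ.filter fun x : L =>
      Algebra.norm K x = u ∧ Algebra.norm K (aeval x f) = v).card : ℝ) ≤
        (Fintype.card L : ℝ) / ((Fintype.card K : ℝ) - 1) ^ 2 +
          204 * (Fintype.card K : ℝ) ^ (m + 2) := by
  set q := Fintype.card K with hq
  obtain ⟨D, hD⟩ : ∃ D, q = D + 1 := ⟨q - 1, by omega⟩
  have hD2 : 2 ≤ D := by omega
  obtain ⟨R, hRdef⟩ : ∃ R, R = q ^ (m + 2) := ⟨_, rfl⟩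
  obtain ⟨l, hl⟩ : ∃ l, l = q ^ m := ⟨_, rfl⟩
  have hl1 : 1 ≤ l := hl ▸ Nat.one_le_pow _ _ (by omega)
  have hRl : R = q ^ 2 * l := by rw [hRdef, hl]; ring
  obtain ⟨E, hE⟩ : ∃ E, E = ∑ i ∈ Finset.range (m + 2), q ^ i := ⟨_, rfl⟩
  have hRE : R = D * E + 1 := by
    have h3 := geom_sum_mul_add D (m + 2)
    rw [← hD] at h3
    rw [hRdef, ← h3, hE, hD, mul_comm]
  have hlE : D * l ≤ E := by
    have h1 : q ^ (m + 1) ≤ E := by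
      rw [hE]
      exact Finset.single_le_sum (f := fun i => q ^ i) (fun _ _ => Nat.zero_le _)
        (Finset.mem_range.mpr (by omega))
    calc D * l ≤ q * l := Nat.mul_le_mul_right _ (by omega)
      _ = q ^ (m + 1) := by rw [hl]; ring
      _ ≤ E := h1
  have hE0 : 0 < E := lt_of_lt_of_le (by positivity) hlE
  have hcount := stepanov_count_lt hD hD2 hl1 hRl
  have hmain := card_norm_fibre_le (L := L) hf hθ hfθ hf'θ (m := m + 2) (E := E) (D := D)
    (M := R / (D * D) + 200)
    (l := l) hm (by omega) hE0 (by rw [← hq, ← hRdef]; exact hRE) hlE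
    (by rw [← hq, ← hRdef]; exact hcount) hu hv
  rw [← hq, ← hRdef] at hmain
  have hcL : Fintype.card L = R * R := by
    rw [Module.card_eq_pow_finrank (K := K), hm, hRdef]; ring
  have hlR : l ≤ R := by rw [hRl]; nlinarith [Nat.one_le_pow 2 q (by omega)]
  have hdiv : ((R / (D * D) : ℕ) : ℝ) ≤ (R : ℝ) / (D : ℝ) ^ 2 := by
    refine Nat.cast_div_le.trans ?_
    push_cast
    rw [sq]
  have hqD : (q : ℝ) - 1 = D := by rw [hD]; push_cast; ring
  rw [hqD, hcL]
  calc _ ≤ ((l + (R / (D * D) + 200 + 3) * R : ℕ) : ℝ) := by exact_mod_cast hmain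
    _ ≤ ((R + ((R / (D * D) : ℕ) + 203) * R : ℕ) : ℝ) := by
      exact_mod_cast Nat.add_le_add_right hlR _
    _ = R + (((R / (D * D) : ℕ) : ℝ) + 203) * R := by push_cast; ring
    _ ≤ R + ((R : ℝ) / (D : ℝ) ^ 2 + 203) * R := by gcongr
    _ = _ := by rw [hRdef]; push_cast; ring

theorem MulChar.norm_apply_le_one {K : Type*} [Field K] [Finite K] (χ : MulChar K ℂ) (x : K) :
    ‖χ x‖ ≤ 1 := by
  by_cases hx : x = 0
  · simp [hx]
  · have : Fintype K := Fintype.ofFinite K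
    have h : (χ x) ^ (Fintype.card K - 1) = 1 := by
      rw [← map_pow, FiniteField.pow_card_sub_one_eq_one x hx, map_one]
    exact (Complex.norm_eq_one_of_pow_eq_one h
      (Nat.sub_pos_of_lt Fintype.one_lt_card).ne').le

theorem sum_mulChar_prod_eq_zero {K : Type*} [Field K] [Fintype K] {χ ψ : MulChar K ℂ}
    (h : χ ≠ 1 ∨ ψ ≠ 1) : ∑ p : K × K, χ p.1 * ψ p.2 = 0 := by
  rw [Fintype.sum_prod_type, ← Finset.sum_mul_sum Finset.univ Finset.univ (fun x => χ x)
    fun x => ψ x]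
  rcases h with h | h
  · rw [MulChar.sum_eq_zero_of_ne_one h, zero_mul]
  · rw [MulChar.sum_eq_zero_of_ne_one h, mul_zero]

theorem card_roots_filter_le {L : Type*} [Field L] [Fintype L] {g : L[X]} (hg : g ≠ 0) :
    (Finset.univ.filter fun x : L => g.eval x = 0).card ≤ g.natDegree :=
  card_le_degree_of_subset_roots (Z := Finset.univ.filter fun x : L => g.eval x = 0)
    fun x hx => by
      rw [mem_roots hg]
      exact (Finset.mem_filter.mp hx).2

theorem norm_sum_norm_le {K L : Type*} [Field K] [Fintype K] [Field L] [Fintype L]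
    [Algebra K L] (hK : 2 < Fintype.card K) {f : K[X]} (hf : f.natDegree ≤ 2)
    {θ : AlgebraicClosure K} (hθ : θ ≠ 0) (hfθ : aeval θ f = 0) (hf'θ : aeval θ (derivative f) ≠ 0)
    {m : ℕ} (hm : Module.finrank K L = 2 * (m + 2)) {χ ψ : MulChar K ℂ} (h : χ ≠ 1 ∨ ψ ≠ 1) :
    ‖∑ x : L, χ (Algebra.norm K x) * ψ (Algebra.norm K (aeval x f))‖ ≤
      207 * (Fintype.card K - 1 : ℝ) ^ 2 * (Fintype.card K : ℝ) ^ (m + 2) := by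
  have hf0 : f ≠ 0 := by rintro rfl; simp at hf'θ
  obtain ⟨N, hN⟩ : ∃ N : K × K → ℝ, ∀ p, N p = ((Finset.univ.filter fun x : L =>
    (Algebra.norm K x, Algebra.norm K (aeval x f)) = p).card : ℝ) := ⟨_, fun _ => rfl⟩
  obtain ⟨U, hU⟩ : ∃ U : ℝ, U = (Fintype.card L : ℝ) / ((Fintype.card K : ℝ) - 1) ^ 2 +
          204 * (Fintype.card K : ℝ) ^ (m + 2) := ⟨_, rfl⟩
  obtain ⟨G, hG⟩ : ∃ G : Finset (K × K), G = ({0}ᶜ : Finset K) ×ˢ ({0}ᶜ : Finset K) := ⟨_, rfl⟩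
  have hGmem : ∀ p, p ∈ G ↔ p.1 ≠ 0 ∧ p.2 ≠ 0 := by intro p; simp [hG]
  have hNU : ∀ p ∈ G, N p ≤ U := by
    intro p hp
    rw [hGmem] at hp
    rw [hN, hU]
    have := card_norm_fibre_le_sq_div (L := L) hK hf hθ hfθ hf'θ hm hp.1 hp.2
    simpa only [Prod.ext_iff] using this
  have hS : ∑ x : L, χ (Algebra.norm K x) * ψ (Algebra.norm K (aeval x f)) =
      ∑ p ∈ G, (N p : ℂ) * (χ p.1 * ψ p.2) := by
    rw [← Finset.sum_fiberwise Finset.univ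
      (fun x : L => (Algebra.norm K x, Algebra.norm K (aeval x f)))]
    rw [← Finset.sum_subset (Finset.subset_univ G)]
    · refine Finset.sum_congr rfl fun p _ => ?_
      rw [hN, Finset.sum_congr rfl (g := fun _ => χ p.1 * ψ p.2)]
      · simp
      · intro x hx
        rw [← (Finset.mem_filter.mp hx).2]
    · intro p _ hp
      refine Finset.sum_eq_zero fun x hx => ?_
      rw [← (Finset.mem_filter.mp hx).2, hGmem, not_and_or, not_not, not_not] at hp
      rcases hp with hp | hp
      · simp only at hp; rw [hp, MulChar.map_zero, zero_mul]
      · simp only at hp; rw [hp, MulChar.map_zero, mul_zero]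
  have hzero : ∑ p ∈ G, (U : ℂ) * (χ p.1 * ψ p.2) = 0 := by
    rw [← Finset.mul_sum, Finset.sum_subset (Finset.subset_univ G), sum_mulChar_prod_eq_zero h,
      mul_zero]
    intro p _ hp
    rw [hGmem, not_and_or, not_not, not_not] at hp
    rcases hp with hp | hp
    · rw [hp, MulChar.map_zero, zero_mul]
    · rw [hp, MulChar.map_zero, mul_zero]
  have hS2 : ∑ x : L, χ (Algebra.norm K x) * ψ (Algebra.norm K (aeval x f)) =
      - ∑ p ∈ G, ((U - N p : ℝ) : ℂ) * (χ p.1 * ψ p.2) := by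
    have e : ∑ p ∈ G, ((U - N p : ℝ) : ℂ) * (χ p.1 * ψ p.2) =
        ∑ p ∈ G, (U : ℂ) * (χ p.1 * ψ p.2) - ∑ p ∈ G, (N p : ℂ) * (χ p.1 * ψ p.2) := by
      rw [← Finset.sum_sub_distrib]
      refine Finset.sum_congr rfl fun p _ => ?_
      push_cast; ring
    rw [e, hzero, hS]; ring
  have hq1 : (1 : ℝ) ≤ (Fintype.card K : ℝ) - 1 := by
    have : (3 : ℝ) ≤ Fintype.card K := by exact_mod_cast hK
    linarith
  have hGcard : (G.card : ℝ) = ((Fintype.card K : ℝ) - 1) ^ 2 := by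
    rw [hG, Finset.card_product, Finset.card_compl, Finset.card_singleton]
    rw [Nat.cast_mul, Nat.cast_sub Fintype.card_pos]; push_cast; ring
  have hNsum : (Fintype.card L : ℝ) - 3 ≤ ∑ p ∈ G, N p := by
    have h1 : ∑ p ∈ G, N p = ((Finset.univ.filter fun x : L =>
        (Algebra.norm K x, Algebra.norm K (aeval x f)) ∈ G).card : ℝ) := by
      rw [Finset.card_eq_sum_card_fiberwise (t := G) (s := Finset.univ.filter fun x : L =>
        (Algebra.norm K x, Algebra.norm K (aeval x f)) ∈ G)
        (f := fun x : L => (Algebra.norm K x, Algebra.norm K (aeval x f)))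
        (fun x hx => by simpa using hx)]
      push_cast
      refine Finset.sum_congr rfl fun p hp => ?_
      rw [hN, Finset.filter_filter]
      congr 2
      ext x
      simp only [Finset.mem_filter, Finset.mem_univ, true_and]
      exact ⟨fun e => ⟨e ▸ hp, e⟩, fun e => e.2⟩
    have hne : (X * f.map (algebraMap K L)) ≠ 0 := mul_ne_zero X_ne_zero
      ((Polynomial.map_ne_zero_iff (algebraMap K L).injective).mpr hf0)
    have h2 := card_roots_filter_le hne
    have h3 : (X * f.map (algebraMap K L)).natDegree ≤ 3 := by
      refine natDegree_mul_le.trans ?_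
      rw [natDegree_map, natDegree_X]; omega
    have h4 := Finset.card_filter_add_card_filter_not (s := (Finset.univ : Finset L))
      (fun x => (X * f.map (algebraMap K L)).eval x = 0)
    have h5 : (Finset.univ.filter fun x : L => ¬ (X * f.map (algebraMap K L)).eval x = 0) =
        Finset.univ.filter fun x : L =>
        (Algebra.norm K x, Algebra.norm K (aeval x f)) ∈ G := by
      ext x
      simp only [Finset.mem_filter, Finset.mem_univ, true_and, hGmem, eval_mul, eval_X, mul_eq_zero,
        not_or, eval_map_algebraMap, ne_eq, Algebra.norm_eq_zero_iff]
    rw [h1, ← h5]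
    rw [Finset.card_univ] at h4
    have h6 : Fintype.card L ≤ (Finset.univ.filter fun x : L =>
      ¬ (X * f.map (algebraMap K L)).eval x = 0).card + 3 := by omega
    have : (Fintype.card L : ℝ) ≤ ((Finset.univ.filter fun x : L =>
      ¬ (X * f.map (algebraMap K L)).eval x = 0).card : ℝ) + 3 := by exact_mod_cast h6
    linarith
  rw [hS2, norm_neg]
  calc _ ≤ ∑ p ∈ G, (U - N p) := by
        refine (norm_sum_le _ _).trans (Finset.sum_le_sum fun p hp => ?_)
        rw [norm_mul, Complex.norm_real, Real.norm_eq_abs, abs_of_nonneg (by linarith [hNU p hp]),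
          norm_mul]
        have := mul_le_one₀ (MulChar.norm_apply_le_one χ p.1) (norm_nonneg _)
          (MulChar.norm_apply_le_one ψ p.2)
        exact mul_le_of_le_one_right (by linarith [hNU p hp]) this
    _ = ((Fintype.card K : ℝ) - 1) ^ 2 * U - ∑ p ∈ G, N p := by
        rw [Finset.sum_sub_distrib, Finset.sum_const, nsmul_eq_mul, hGcard]
    _ ≤ ((Fintype.card K : ℝ) - 1) ^ 2 * U - (Fintype.card L - 3) := by linarith
    _ = 204 * (Fintype.card K - 1 : ℝ) ^ 2 * (Fintype.card K : ℝ) ^ (m + 2) + 3 * 1 := by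
        rw [hU]
        field_simp
        ring
    _ ≤ 204 * (Fintype.card K - 1 : ℝ) ^ 2 * (Fintype.card K : ℝ) ^ (m + 2) +
        3 * ((Fintype.card K - 1 : ℝ) ^ 2 * (Fintype.card K : ℝ) ^ (m + 2)) := by
        gcongr
        exact one_le_mul_of_one_le_of_one_le (one_le_pow₀ hq1) (one_le_pow₀ (by linarith))
    _ = _ := by ring

theorem le_one_of_pow_le {x C : ℝ} (h : ∀ n, 2 ≤ n → x ^ n ≤ C) : x ≤ 1 := by
  by_contra! hx
  obtain ⟨n, hn⟩ := pow_unbounded_of_one_lt C hx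
  have h1 := h (n + 2) (by omega)
  have h2 : x ^ n ≤ x ^ (n + 2) := pow_le_pow_right₀ hx.le (by omega)
  linarith

theorem norm_le_one_of_norm_pow_add_pow_le {a b : ℂ} {C : ℝ}
    (h : ∀ n, 2 ≤ n → ‖a ^ n + b ^ n‖ ≤ C) : ‖a‖ ≤ 1 := by
  have hab : ‖a * b‖ ≤ 1 := by
    refine le_one_of_pow_le (C := (C * C + C) / 2) fun n hn => ?_
    have e : 2 * (a * b) ^ n = (a ^ n + b ^ n) * (a ^ n + b ^ n) - (a ^ (2 * n) + b ^ (2 * n)) := by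
      ring
    have h1 : ‖2 * (a * b) ^ n‖ ≤ C * C + C := by
      rw [e]
      refine (norm_sub_le _ _).trans (add_le_add ?_ (h _ (by omega)))
      rw [norm_mul]
      exact mul_le_mul (h n hn) (h n hn) (norm_nonneg _) ((norm_nonneg _).trans (h n hn))
    rw [norm_mul, norm_pow, Complex.norm_ofNat] at h1
    linarith
  by_contra! ha
  have hb : ‖b‖ ≤ 1 := by
    rw [norm_mul] at hab
    nlinarith [norm_nonneg b]
  refine absurd (le_one_of_pow_le (x := ‖a‖) (C := C + 1) fun n hn => ?_) ha.not_ge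
  have : ‖a ^ n‖ ≤ ‖a ^ n + b ^ n‖ + ‖b ^ n‖ := by
    simpa using norm_sub_le (a ^ n + b ^ n) (b ^ n)
  rw [norm_pow, norm_pow] at this
  linarith [h n hn, pow_le_one₀ (n := n) (norm_nonneg b) hb]

theorem norm_add_le_of_norm_pow_add_pow_le {a b : ℂ} {q C : ℝ} (hq : 0 < q)
    (h : ∀ m : ℕ, ‖a ^ (2 * (m + 2)) + b ^ (2 * (m + 2))‖ ≤ C * q ^ (m + 2)) :
    ‖a + b‖ ≤ 2 * √q := by
  have key : ∀ n, 2 ≤ n → ‖(a ^ 2 / q) ^ n + (b ^ 2 / q) ^ n‖ ≤ C := by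
    intro n hn
    obtain ⟨m, rfl⟩ := Nat.exists_eq_add_of_le' hn
    rw [div_pow, div_pow, ← add_div, ← pow_mul, ← pow_mul, norm_div, norm_pow, Complex.norm_real,
      Real.norm_of_nonneg hq.le, div_le_iff₀ (by positivity)]
    exact h m
  have aux : ∀ z : ℂ, ‖z ^ 2 / (q : ℂ)‖ ≤ 1 → ‖z‖ ≤ √q := by
    intro z hz
    rw [norm_div, norm_pow, Complex.norm_real, Real.norm_of_nonneg hq.le, div_le_one hq] at hz
    exact Real.le_sqrt_of_sq_le hz
  have ha := aux a (norm_le_one_of_norm_pow_add_pow_le key)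
  have hb := aux b (norm_le_one_of_norm_pow_add_pow_le fun n hn => by
    rw [add_comm]; exact key n hn)
  linarith [norm_add_le a b]

/-- A sequence of power sums determined through Newton's identities by two coefficients. -/
theorem exists_power_sums {S : ℕ → ℂ} {A B : ℂ} (h1 : S 1 = A) (h2 : S 2 + A * S 1 = 2 * B)
    (h3 : ∀ n, S (n + 3) + A * S (n + 2) + B * S (n + 1) = 0) :
    ∃ α β : ℂ, ∀ n, S (n + 1) = -(α ^ (n + 1) + β ^ (n + 1)) := by
  obtain ⟨s, hs⟩ := IsAlgClosed.exists_pow_nat_eq (A ^ 2 - 4 * B) zero_lt_two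
  obtain ⟨α, hα⟩ : ∃ α, α = (-A + s) / 2 := ⟨_, rfl⟩
  obtain ⟨β, hβ⟩ : ∃ β, β = (-A - s) / 2 := ⟨_, rfl⟩
  have hA : A = -(α + β) := by rw [hα, hβ]; ring
  have hB : B = α * β := by rw [hα, hβ]; linear_combination (1 / 4) * hs
  have e2 : S 2 = 2 * B - A * S 1 := by linear_combination h2
  refine ⟨α, β, fun n => ?_⟩
  induction n using Nat.strong_induction_on with
  | _ n ih =>
    match n, ih with
    | 0, _ => rw [zero_add, h1, hA]; ring
    | 1, _ => rw [one_add_one_eq_two, e2, h1, hA, hB]; ring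
    | n + 2, ih =>
      have i1 := ih (n + 1) (by omega)
      have i0 := ih n (by omega)
      have h := h3 n
      rw [i1, i0, hA, hB] at h
      linear_combination h

theorem finite_monic_natDegree (K : Type*) [Field K] [Finite K] (n : ℕ) :
    {g : K[X] | g.Monic ∧ g.natDegree = n}.Finite := by
  refine Set.Finite.of_finite_image (f := fun (g : K[X]) (i : Fin (n + 1)) => g.coeff i)
    (Set.toFinite _) fun g hg h hh e => ?_
  ext i
  by_cases hi : i < n + 1
  · exact congrFun e ⟨i, hi⟩
  · rw [coeff_eq_zero_of_natDegree_lt (by have := hg.2; omega),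
      coeff_eq_zero_of_natDegree_lt (by have := hh.2; omega)]

/-- The finite set of monic polynomials of degree `n` over a finite field. -/
noncomputable def monics (K : Type*) [Field K] [Finite K] (n : ℕ) : Finset K[X] :=
  (finite_monic_natDegree K n).toFinset

theorem card_filter_pow_dvd {K : Type*} [Field K] {g P : K[X]} (hg : g ≠ 0) (hP : Irreducible P)
    (hPm : P.Monic) :
    ((Finset.Icc 1 g.natDegree).filter fun m => P ^ m ∣ g).card =
      (UniqueFactorizationMonoid.normalizedFactors g).count P := by
  have key : ∀ m, P ^ m ∣ g ↔ m ≤ (UniqueFactorizationMonoid.normalizedFactors g).count P := by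
    intro m
    rw [pow_dvd_iff_le_emultiplicity,
      UniqueFactorizationMonoid.emultiplicity_eq_count_normalizedFactors hP hg,
      hPm.normalize_eq_self, Nat.cast_le]
  have : ((Finset.Icc 1 g.natDegree).filter fun m => P ^ m ∣ g) =
      Finset.Icc 1 ((UniqueFactorizationMonoid.normalizedFactors g).count P) := by
    ext m
    simp only [Finset.mem_filter, Finset.mem_Icc, key]
    refine ⟨fun h => ⟨h.1.1, h.2⟩, fun h => ⟨⟨h.1, ?_⟩, h.2⟩⟩
    have h1 := natDegree_le_of_dvd ((key m).mpr h.2) hg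
    rw [natDegree_pow] at h1
    exact (Nat.le_mul_of_pos_right m hP.natDegree_pos).trans h1
  rw [this, Nat.card_Icc, Nat.add_sub_cancel]

section monics

variable {K : Type*} [Field K] [Finite K]

theorem mem_monics {n : ℕ} {g : K[X]} : g ∈ monics K n ↔ g.Monic ∧ g.natDegree = n := by
  simp [monics]

theorem natDegree_eq_sum_count {g : K[X]} (hg : g.Monic) :
    g.natDegree = ∑ d ∈ Finset.Icc 1 g.natDegree, ∑ P ∈ (monics K d).filter Irreducible,
      d * ((Finset.Icc 1 g.natDegree).filter fun m => P ^ m ∣ g).card := by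
  have hprod : (UniqueFactorizationMonoid.normalizedFactors g).prod = g := by
    rw [UniqueFactorizationMonoid.prod_normalizedFactors_eq hg.ne_zero, hg.normalize_eq_self]
  have hmem : ∀ P ∈ UniqueFactorizationMonoid.normalizedFactors g,
      Irreducible P ∧ P.Monic ∧ P.natDegree ≤ g.natDegree := fun P hP =>
    have hi := UniqueFactorizationMonoid.irreducible_of_normalized_factor P hP
    ⟨hi, by
      rw [← UniqueFactorizationMonoid.normalize_normalized_factor P hP]
      exact monic_normalize hi.ne_zero,
      natDegree_le_of_dvd (UniqueFactorizationMonoid.dvd_of_mem_normalizedFactors hP) hg.ne_zero⟩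
  have h1 : g.natDegree = ∑ P ∈ (UniqueFactorizationMonoid.normalizedFactors g).toFinset,
      P.natDegree * (UniqueFactorizationMonoid.normalizedFactors g).count P := by
    conv_lhs => rw [← hprod]
    rw [natDegree_multiset_prod _ (UniqueFactorizationMonoid.zero_notMem_normalizedFactors _),
      Finset.sum_multiset_map_count]
    simp only [smul_eq_mul, mul_comm]
  conv_lhs => rw [h1]
  rw [← Finset.sum_fiberwise_of_maps_to (t := Finset.Icc 1 g.natDegree) (g := natDegree)]
  · refine Finset.sum_congr rfl fun d hd => ?_
    refine (Finset.sum_congr rfl fun P hP => ?_).trans (Finset.sum_subset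
      (f := fun P => d * ((Finset.Icc 1 g.natDegree).filter fun m => P ^ m ∣ g).card) ?_ ?_)
    · obtain ⟨hP1, hP2⟩ := Finset.mem_filter.mp hP
      obtain ⟨hi, hm, -⟩ := hmem P (Multiset.mem_toFinset.mp hP1)
      rw [card_filter_pow_dvd hg.ne_zero hi hm, hP2]
    · intro P hP
      obtain ⟨hP1, hP2⟩ := Finset.mem_filter.mp hP
      obtain ⟨hi, hm, -⟩ := hmem P (Multiset.mem_toFinset.mp hP1)
      exact Finset.mem_filter.mpr ⟨mem_monics.mpr ⟨hm, hP2⟩, hi⟩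
    · intro P hP hP'
      obtain ⟨hP1, hi⟩ := Finset.mem_filter.mp hP
      obtain ⟨hm, hd⟩ := mem_monics.mp hP1
      rw [card_filter_pow_dvd hg.ne_zero hi hm, Multiset.count_eq_zero_of_notMem, mul_zero]
      intro h
      exact hP' (Finset.mem_filter.mpr ⟨Multiset.mem_toFinset.mpr h, hd⟩)
  · intro P hP
    obtain ⟨hi, hm, hd⟩ := hmem P (Multiset.mem_toFinset.mp hP)
    exact Finset.mem_Icc.mpr ⟨hi.natDegree_pos, hd⟩

theorem sum_monics_filter_dvd (Λ : K[X] →* ℂ) {Q : K[X]} (hQ : Q.Monic) (n : ℕ) :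
    ∑ g ∈ (monics K n).filter (Q ∣ ·), Λ g =
      if Q.natDegree ≤ n then Λ Q * ∑ g ∈ monics K (n - Q.natDegree), Λ g else 0 := by
  split_ifs with h
  · rw [Finset.mul_sum]
    symm
    refine Finset.sum_bij (fun h _ => Q * h) ?_ ?_ ?_ ?_
    · intro g hg
      obtain ⟨hm, hd⟩ := mem_monics.mp hg
      refine Finset.mem_filter.mpr ⟨mem_monics.mpr ⟨hQ.mul hm, ?_⟩, dvd_mul_right _ _⟩
      rw [hQ.natDegree_mul hm, hd]; omega
    · intro g _ g' _ e
      exact mul_left_cancel₀ hQ.ne_zero e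
    · intro g hg
      obtain ⟨hg1, ⟨u, rfl⟩⟩ := Finset.mem_filter.mp hg
      obtain ⟨hm, hd⟩ := mem_monics.mp hg1
      have hu := hQ.of_mul_monic_left hm
      refine ⟨u, mem_monics.mpr ⟨hu, ?_⟩, rfl⟩
      rw [hQ.natDegree_mul hu] at hd; omega
    · intro g _
      rw [map_mul]
  · refine Finset.sum_eq_zero fun g hg => absurd ?_ h
    obtain ⟨hg1, hdvd⟩ := Finset.mem_filter.mp hg
    obtain ⟨hm, hd⟩ := mem_monics.mp hg1
    exact hd ▸ natDegree_le_of_dvd hdvd hm.ne_zero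

/-- Newton's identities for the Euler product of a multiplicative function on polynomials. -/
theorem newton_monics (Λ : K[X] →* ℂ) (n : ℕ) :
    (n : ℂ) * ∑ g ∈ monics K n, Λ g = ∑ j ∈ Finset.Icc 1 n,
      (∑ d ∈ j.divisors, ∑ P ∈ (monics K d).filter Irreducible, (d : ℂ) * Λ P ^ (j / d)) *
        ∑ g ∈ monics K (n - j), Λ g := by
  have h1 : (n : ℂ) * ∑ g ∈ monics K n, Λ g = ∑ d ∈ Finset.Icc 1 n,
      ∑ P ∈ (monics K d).filter Irreducible, ∑ m ∈ Finset.Icc 1 n,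
        (d : ℂ) * ∑ g ∈ (monics K n).filter (P ^ m ∣ ·), Λ g := by
    have e : ∀ g ∈ monics K n, (n : ℂ) * Λ g = ∑ d ∈ Finset.Icc 1 n,
      ∑ P ∈ (monics K d).filter Irreducible, ∑ m ∈ Finset.Icc 1 n,
        (d : ℂ) * if P ^ m ∣ g then Λ g else 0 := by
      intro g hg
      obtain ⟨hm, hd⟩ := mem_monics.mp hg
      have h := natDegree_eq_sum_count hm
      rw [hd] at h
      conv_lhs => rw [h]
      push_cast
      simp only [Finset.sum_mul]
      refine Finset.sum_congr rfl fun d _ => Finset.sum_congr rfl fun P _ => ?_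
      rw [← Finset.mul_sum, Finset.sum_ite, Finset.sum_const_zero, add_zero, Finset.sum_const,
        nsmul_eq_mul, mul_assoc]
    rw [Finset.mul_sum, Finset.sum_congr rfl e, Finset.sum_comm]
    refine Finset.sum_congr rfl fun d _ => ?_
    rw [Finset.sum_comm]
    refine Finset.sum_congr rfl fun P _ => ?_
    rw [Finset.sum_comm]
    refine Finset.sum_congr rfl fun m _ => ?_
    rw [← Finset.mul_sum, Finset.sum_filter]
  have h2 : ∀ j ∈ Finset.Icc 1 n,
      (∑ d ∈ j.divisors, ∑ P ∈ (monics K d).filter Irreducible, (d : ℂ) * Λ P ^ (j / d)) *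
        ∑ g ∈ monics K (n - j), Λ g = ∑ d ∈ Finset.Icc 1 n,
      ∑ P ∈ (monics K d).filter Irreducible, if d ∣ j then (d : ℂ) * (Λ P ^ (j / d) *
        ∑ g ∈ monics K (n - j), Λ g) else 0 := by
    intro j hj
    rw [Finset.mem_Icc] at hj
    have e : j.divisors = (Finset.Icc 1 n).filter (· ∣ j) := by
      ext d
      simp only [Nat.mem_divisors, Finset.mem_filter, Finset.mem_Icc]
      exact ⟨fun h => ⟨⟨Nat.pos_of_dvd_of_pos h.1 hj.1, (Nat.le_of_dvd hj.1 h.1).trans hj.2⟩, h.1⟩,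
        fun h => ⟨h.2, by omega⟩⟩
    rw [e, Finset.sum_filter, Finset.sum_mul]
    refine Finset.sum_congr rfl fun d _ => ?_
    split_ifs
    · rw [Finset.sum_mul]
      exact Finset.sum_congr rfl fun P _ => mul_assoc _ _ _
    · rw [zero_mul, Finset.sum_const_zero]
  rw [h1, Finset.sum_congr rfl h2, Finset.sum_comm]
  refine Finset.sum_congr rfl fun d hd => ?_
  rw [Finset.sum_comm (s := Finset.Icc 1 n)]
  refine Finset.sum_congr rfl fun P hP => ?_
  obtain ⟨hP1, hi⟩ := Finset.mem_filter.mp hP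
  obtain ⟨hm, rfl⟩ := mem_monics.mp hP1
  simp only [sum_monics_filter_dvd Λ (hm.pow _), natDegree_pow, map_pow, mul_ite, mul_zero]
  rw [← Finset.sum_filter, ← Finset.sum_filter]
  have hpos := hi.natDegree_pos
  refine Finset.sum_bij' (fun m _ => m * P.natDegree) (fun j _ => j / P.natDegree) ?_ ?_ ?_ ?_ ?_
  · intro m hm
    simp only [Finset.mem_filter, Finset.mem_Icc] at hm ⊢
    exact ⟨⟨Nat.mul_pos hm.1.1 hpos, hm.2⟩, dvd_mul_left _ _⟩
  · intro j hj
    simp only [Finset.mem_filter, Finset.mem_Icc] at hj ⊢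
    exact ⟨⟨Nat.div_pos (Nat.le_of_dvd hj.1.1 hj.2) hpos, (Nat.div_le_self _ _).trans hj.1.2⟩,
      by rw [Nat.div_mul_cancel hj.2]; exact hj.1.2⟩
  · intro m _
    exact Nat.mul_div_cancel _ hpos
  · intro j hj
    exact Nat.div_mul_cancel (Finset.mem_filter.mp hj).2
  · intro m _
    rw [Nat.mul_div_cancel _ hpos]

end monics

theorem card_minpoly_eq {K L : Type*} [Field K] [Fintype K] [Field L] [Fintype L] [Algebra K L]
    {P : K[X]} (hi : Irreducible P) (hm : P.Monic) (hd : P.natDegree ∣ Module.finrank K L) :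
    (Finset.univ.filter fun x : L => minpoly K x = P).card = P.natDegree := by
  have hdvd : P ∣ X ^ Fintype.card L - X := by
    rw [Module.card_eq_pow_finrank (K := K), ← Nat.card_eq_fintype_card]
    exact hi.natDegree_dvd_iff_dvd_X_pow_card_pow_sub_X.mp hd
  have hsplit : (P.map (algebraMap K L)).Splits := by
    have h1 := Polynomial.map_dvd (algebraMap K L) hdvd
    refine (FiniteField.isSplittingField_sub L K).splits.of_dvd
      ((Polynomial.map_ne_zero_iff (algebraMap K L).injective).mpr ?_) h1
    exact FiniteField.X_pow_card_sub_X_ne_zero K Fintype.one_lt_card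
  have hsep : P.Separable := PerfectField.separable_of_irreducible hi
  rw [← card_rootSet_eq_natDegree hsep hsplit, ← Fintype.card_coe]
  refine Fintype.card_congr (Equiv.subtypeEquivRight fun x => ?_)
  rw [Finset.mem_filter, mem_rootSet]
  constructor
  · rintro ⟨-, rfl⟩
    exact ⟨hi.ne_zero, minpoly.aeval K x⟩
  · rintro ⟨-, hx⟩
    exact ⟨Finset.mem_univ _, (minpoly.eq_of_irreducible_of_monic hi hx hm).symm⟩

theorem sum_map_minpoly {K L : Type*} [Field K] [Fintype K] [Field L] [Fintype L] [Algebra K L]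
    (Λ : K[X] →* ℂ) {n : ℕ} (hn : Module.finrank K L = n) :
    ∑ x : L, Λ (minpoly K x) ^ (n / (minpoly K x).natDegree) =
      ∑ d ∈ n.divisors, ∑ P ∈ (monics K d).filter Irreducible, (d : ℂ) * Λ P ^ (n / d) := by
  have hint : ∀ x : L, IsIntegral K x := fun x => Algebra.IsIntegral.isIntegral x
  have hmem : ∀ x : L, (minpoly K x).natDegree ∈ n.divisors := fun x =>
    Nat.mem_divisors.mpr ⟨hn ▸ minpoly.degree_dvd (hint x), hn ▸ Module.finrank_pos.ne'⟩
  rw [← Finset.sum_fiberwise_of_maps_to (t := n.divisors)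
    (g := fun x : L => (minpoly K x).natDegree) (fun x _ => hmem x)]
  refine Finset.sum_congr rfl fun d hd => ?_
  rw [← Finset.sum_fiberwise_of_maps_to (t := (monics K d).filter Irreducible)
    (g := fun x : L => minpoly K x)]
  · refine Finset.sum_congr rfl fun P hP => ?_
    obtain ⟨hP1, hi⟩ := Finset.mem_filter.mp hP
    obtain ⟨hm, rfl⟩ := mem_monics.mp hP1
    have hcard := card_minpoly_eq (L := L) hi hm (hn ▸ Nat.dvd_of_mem_divisors hd)
    rw [Finset.sum_congr rfl (g := fun _ => Λ P ^ (n / P.natDegree)), Finset.sum_const,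
      nsmul_eq_mul, Finset.filter_filter]
    · congr 2
      refine (congrArg Finset.card ?_).trans hcard
      ext x
      simp only [Finset.mem_filter, Finset.mem_univ, true_and]
      exact ⟨fun h => h.2, fun h => ⟨h ▸ rfl, h⟩⟩
    · intro x hx
      rw [(Finset.mem_filter.mp hx).2]
  · intro x hx
    exact Finset.mem_filter.mpr ⟨mem_monics.mpr ⟨minpoly.monic (hint x),
      (Finset.mem_filter.mp hx).2⟩,
      minpoly.irreducible (hint x)⟩

/-- The companion matrix of `X ^ 2 + p X + r`. -/
def companionTwo {K : Type*} [Field K] (p r : K) : Matrix (Fin 2) (Fin 2) K := !![0, -r; 1, -p]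

/-- The resultant of `X ^ 2 + p X + r` with a polynomial, as a monoid homomorphism. -/
noncomputable def resTwo {K : Type*} [Field K] (p r : K) : K[X] →* K :=
  Matrix.detMonoidHom.comp (aeval (R := K) (companionTwo p r) : K[X] →* Matrix (Fin 2) (Fin 2) K)

section

variable {K : Type*} [Field K]

theorem resTwo_apply (p r : K) (g : K[X]) : resTwo p r g = (aeval (companionTwo p r) g).det := rfl

theorem aeval_companionTwo_self (p r : K) :
    aeval (companionTwo p r) (X ^ 2 + C p * X + C r) = 0 := by
  simp only [map_add, map_mul, map_pow, aeval_X, aeval_C]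
  ext i j
  fin_cases i <;> fin_cases j <;>
    simp [companionTwo, pow_two, Matrix.mul_apply, Matrix.algebraMap_matrix_apply, mul_comm]

theorem resTwo_X_sub_C (p r t : K) : resTwo p r (X - C t) = t ^ 2 + p * t + r := by
  rw [resTwo_apply, map_sub, aeval_X, aeval_C, Matrix.det_fin_two]
  simp [companionTwo, Matrix.algebraMap_matrix_apply]
  ring

theorem resTwo_eq_of_dvd_sub {p r : K} {g h : K[X]} (hd : (X ^ 2 + C p * X + C r) ∣ g - h) :
    resTwo p r g = resTwo p r h := by
  obtain ⟨s, hs⟩ := hd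
  have : aeval (companionTwo p r) (g - h) = 0 := by
    rw [hs, map_mul, aeval_companionTwo_self, zero_mul]
  rw [map_sub, sub_eq_zero] at this
  rw [resTwo_apply, this, resTwo_apply]

theorem algebraMap_resTwo {E : Type*} [Field E] [Algebra K E] (p r : K) (g : K[X]) :
    algebraMap K E (resTwo p r g) =
      resTwo (algebraMap K E p) (algebraMap K E r) (g.map (algebraMap K E)) := by
  have hc : companionTwo (algebraMap K E p) (algebraMap K E r) =
      (Algebra.ofId K E).mapMatrix (companionTwo p r) := by
    ext i j
    fin_cases i <;> fin_cases j <;> simp [companionTwo, Algebra.ofId_apply]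
  rw [resTwo_apply, resTwo_apply, hc, aeval_map_algebraMap, aeval_algHom_apply, ← AlgHom.map_det]
  rfl

theorem resTwo_eq_prod_roots {p r : K} {g : K[X]} (hg : g.Monic) (hs : g.Splits) :
    resTwo p r g = (g.roots.map fun t => t ^ 2 + p * t + r).prod := by
  conv_lhs => rw [hs.eq_prod_roots_of_monic hg]
  rw [map_multiset_prod, Multiset.map_map]
  simp only [Function.comp_def, resTwo_X_sub_C]

end

section

variable {K L : Type*} [Field K] [Field L] [Algebra K L] [FiniteDimensional K L]

theorem norm_algebraMap_adjoin (x : L) (y : IntermediateField.adjoin K {x}) :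
    Algebra.norm K (algebraMap _ L y) =
      Algebra.norm K y ^ (Module.finrank K L / (minpoly K x).natDegree) := by
  have hx : IsIntegral K x := Algebra.IsIntegral.isIntegral x
  have h : Module.finrank K L / (minpoly K x).natDegree =
      Module.finrank (IntermediateField.adjoin K {x}) L := by
    rw [← Module.finrank_mul_finrank K (IntermediateField.adjoin K {x}) L,
      IntermediateField.adjoin.finrank hx, Nat.mul_div_cancel_left _ (minpoly.natDegree_pos hx)]
  rw [h, ← Algebra.norm_norm (S := IntermediateField.adjoin K {x}), Algebra.norm_algebraMap,
    map_pow]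

theorem norm_eq_coeff_zero_minpoly_pow (x : L) :
    Algebra.norm K x = ((-1) ^ (minpoly K x).natDegree * (minpoly K x).eval 0) ^
      (Module.finrank K L / (minpoly K x).natDegree) := by
  have hx : IsIntegral K x := Algebra.IsIntegral.isIntegral x
  have h := norm_algebraMap_adjoin x (IntermediateField.AdjoinSimple.gen K x)
  rw [IntermediateField.AdjoinSimple.algebraMap_gen] at h
  rw [h, ← IntermediateField.adjoin.powerBasis_gen hx,
    Algebra.PowerBasis.norm_gen_eq_coeff_zero_minpoly, IntermediateField.adjoin.powerBasis_gen hx,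
    IntermediateField.adjoin.powerBasis_dim hx, IntermediateField.minpoly_gen,
    coeff_zero_eq_eval_zero]

theorem PowerBasis.prod_embeddings_eq_prod_roots {K S E M : Type*} [Field K] [Field S] [Field E]
    [CommMonoid M] [Algebra K S] [Algebra K E] [Fintype (S →ₐ[K] E)] (pb : PowerBasis K S)
    (hs : IsSeparable K pb.gen) (φ : E → M) :
    ∏ σ : S →ₐ[K] E, φ (σ pb.gen) = (((minpoly K pb.gen).aroots E).map φ).prod := by
  rw [Fintype.prod_equiv pb.liftEquiv' (fun σ => φ (σ pb.gen)) (fun x => φ x)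
    (fun σ => by simp only [PowerBasis.liftEquiv'_apply_coe])]
  rw [Finset.prod_mem_multiset _ (fun x => φ x) φ (fun _ => rfl), Finset.prod_eq_multiset_prod,
    Multiset.toFinset_val, Multiset.dedup_eq_self.mpr]
  exact nodup_roots (.map hs)

theorem norm_quadratic_eq_resTwo_pow [Algebra.IsSeparable K L] {a : K} (ha : a ≠ 0) (b c : K)
    (x : L) :
    Algebra.norm K (aeval x (C a * X ^ 2 + C b * X + C c)) =
      (a ^ (minpoly K x).natDegree * resTwo (b / a) (c / a) (minpoly K x)) ^
      (Module.finrank K L / (minpoly K x).natDegree) := by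
  have hx : IsIntegral K x := Algebra.IsIntegral.isIntegral x
  have h := norm_algebraMap_adjoin x
    (aeval (IntermediateField.AdjoinSimple.gen K x) (C a * X ^ 2 + C b * X + C c))
  rw [← aeval_algebraMap_apply, IntermediateField.AdjoinSimple.algebraMap_gen] at h
  rw [h]
  congr 1
  have : Algebra.IsSeparable K (IntermediateField.adjoin K {x}) :=
    Algebra.isSeparable_tower_bot_of_isSeparable K _ L
  have hfd : FiniteDimensional K (IntermediateField.adjoin K {x}) := inferInstance
  apply (algebraMap K (AlgebraicClosure K)).injective
  have hsplit : ((minpoly K x).map (algebraMap K (AlgebraicClosure K))).Splits :=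
    IsAlgClosed.splits _
  rw [Algebra.norm_eq_prod_embeddings, map_mul, algebraMap_resTwo,
    resTwo_eq_prod_roots ((minpoly.monic hx).map _) hsplit]
  have hgen : minpoly K (IntermediateField.adjoin.powerBasis hx).gen = minpoly K x := by
    rw [IntermediateField.adjoin.powerBasis_gen hx, IntermediateField.minpoly_gen]
  have hprod := PowerBasis.prod_embeddings_eq_prod_roots (E := AlgebraicClosure K)
    (IntermediateField.adjoin.powerBasis hx) (Algebra.IsSeparable.isSeparable K _)
    (fun t => aeval t (C a * X ^ 2 + C b * X + C c))
  rw [hgen] at hprod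
  simp only [IntermediateField.adjoin.powerBasis_gen hx] at hprod
  simp only [← aeval_algHom_apply]
  rw [hprod, ← aroots_def, map_pow]
  have hcard : (minpoly K x).natDegree =
      Multiset.card ((minpoly K x).aroots (AlgebraicClosure K)) := by
    rw [aroots_def, ← hsplit.natDegree_eq_card_roots, natDegree_map]
  have ha' : algebraMap K (AlgebraicClosure K) a ≠ 0 :=
    (map_ne_zero_iff _ (algebraMap K (AlgebraicClosure K)).injective).mpr ha
  rw [hcard, Multiset.map_congr rfl (g := fun t => algebraMap K (AlgebraicClosure K) a *
    (t ^ 2 + algebraMap K (AlgebraicClosure K) (b / a) * t +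
      algebraMap K (AlgebraicClosure K) (c / a))), Multiset.prod_map_mul, Multiset.map_const',
    Multiset.prod_replicate]
  intro t _
  simp only [map_add, map_mul, map_pow, aeval_C, aeval_X, map_div₀]
  field_simp

end

section

variable {K : Type*} [Field K]

/-- The multiplicative function on polynomials attached to `x ↦ χ x * ψ (a x ^ 2 + b x + c)`. -/
noncomputable def polyChar (χ ψ : MulChar K ℂ) (a b c : K) : K[X] →* ℂ where
  toFun g := (χ (-1) * ψ a) ^ g.natDegree * (χ (g.eval 0) * ψ (resTwo (b / a) (c / a) g))
  map_one' := by simp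
  map_mul' g h := by
    by_cases hg : g = 0
    · simp [hg, MulChar.map_zero]
    by_cases hh : h = 0
    · simp [hh, MulChar.map_zero]
    rw [natDegree_mul hg hh, eval_mul, map_mul, map_mul, map_mul, pow_add]
    ring

theorem polyChar_apply (χ ψ : MulChar K ℂ) (a b c : K) (g : K[X]) : polyChar χ ψ a b c g =
    (χ (-1) * ψ a) ^ g.natDegree * (χ (g.eval 0) * ψ (resTwo (b / a) (c / a) g)) := rfl

theorem polyChar_minpoly_pow {L : Type*} [Field L] [Algebra K L] [FiniteDimensional K L]
    [Algebra.IsSeparable K L] (χ ψ : MulChar K ℂ) {a : K} (ha : a ≠ 0) (b c : K) (x : L) :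
    polyChar χ ψ a b c (minpoly K x) ^ (Module.finrank K L / (minpoly K x).natDegree) =
      χ (Algebra.norm K x) * ψ (Algebra.norm K (aeval x (C a * X ^ 2 + C b * X + C c))) := by
  rw [norm_quadratic_eq_resTwo_pow ha, norm_eq_coeff_zero_minpoly_pow, map_pow, map_pow, ← mul_pow,
    polyChar_apply, map_mul, map_mul, map_pow, map_pow, mul_pow]
  ring

theorem self_eq_add_modByMonic {F g w w' : K[X]} (hF : F.Monic)
    (hw : F ∣ w' * w - 1) {g' : K[X]} (hg' : g' = g + ((w - 1) * g) %ₘ F) :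
    g' + ((w' - 1) * g') %ₘ F = g := by
  have hlt : ((w - 1) * g %ₘ F + (w' - 1) * g' %ₘ F).degree < F.degree :=
    (degree_add_le _ _).trans_lt (max_lt (degree_modByMonic_lt _ hF) (degree_modByMonic_lt _ hF))
  have hz : (w - 1) * g %ₘ F + (w' - 1) * g' %ₘ F = 0 := by
    refine eq_zero_of_dvd_of_degree_lt ?_ hlt
    have h1 := modByMonic_add_div ((w - 1) * g) F
    have h2 := modByMonic_add_div ((w' - 1) * g') F
    obtain ⟨s, hs⟩ := hw
    refine ⟨g * s - w' * ((w - 1) * g /ₘ F) - (w' - 1) * g' /ₘ F, ?_⟩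
    linear_combination g * hs + w' * h1 + h2 + (w' - 1) * hg'
  rw [add_comm ((w - 1) * g %ₘ F)] at hz
  rw [hg'] at hz ⊢
  linear_combination hz

theorem sum_monics_eq_zero [Finite K] {χ : MulChar K ℂ} (hχ : χ ≠ 1) (ψ : MulChar K ℂ) (a b : K)
    {c : K} (hac : c / a ≠ 0) {n : ℕ} (hn : 3 ≤ n) :
    ∑ g ∈ monics K n, polyChar χ ψ a b c g = 0 := by
  obtain ⟨u, hu⟩ : ∃ u : Kˣ, χ u ≠ 1 := by
    by_contra! h
    exact hχ (MulChar.ext fun u => by rw [h u, MulChar.one_apply_coe])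
  obtain ⟨r, hr⟩ : ∃ r, r = c / a := ⟨_, rfl⟩
  obtain ⟨p, hp⟩ : ∃ p, p = b / a := ⟨_, rfl⟩
  rw [← hr] at hac
  obtain ⟨f, hf⟩ : ∃ f : K[X], f = X ^ 2 + C p * X + C r := ⟨_, rfl⟩
  have hfm : f.Monic := by rw [hf]; monicity!
  have hfd : f.natDegree = 2 := by rw [hf]; compute_degree!
  have hFm : (X * f).Monic := monic_X.mul hfm
  have hFd : (X * f).natDegree = 3 := by rw [monic_X.natDegree_mul hfm, hfd, natDegree_X]
  have hFdeg : (X * f).degree = 3 := by rw [degree_eq_natDegree hFm.ne_zero, hFd]; rfl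
  obtain ⟨W, hW⟩ : ∃ W : K → K[X], ∀ t, W t = 1 + C ((t - 1) / r) * f := ⟨_, fun _ => rfl⟩
  have hWW : ∀ s t : K, s * t = 1 → X * f ∣ W s * W t - 1 := by
    intro s t hst
    have h1 : (X : K[X]) ∣ f - C r := ⟨X + C p, by rw [hf]; ring⟩
    obtain ⟨v, hv⟩ := h1
    refine ⟨C ((s - 1) / r * ((t - 1) / r)) * v, ?_⟩
    have h2 : (C ((s - 1) / r) + C ((t - 1) / r) + C ((s - 1) / r * ((t - 1) / r)) * C r : K[X]) =
        0 := by
      rw [← C_mul, ← C_add, ← C_add, C_eq_zero]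
      field_simp
      linear_combination hst
    rw [hW, hW, C_mul] at *
    linear_combination (C ((s - 1) / r) * C ((t - 1) / r)) * f * hv + f * h2
  obtain ⟨σ, hσ⟩ : ∃ σ : K → K[X] → K[X], ∀ t g, σ t g = g + ((W t - 1) * g) %ₘ (X * f) :=
    ⟨_, fun _ _ => rfl⟩
  have hinv : ∀ s t : K, s * t = 1 → ∀ g, σ s (σ t g) = g := by
    intro s t hst g
    rw [hσ s]
    exact self_eq_add_modByMonic hFm (hWW s t hst) (hσ t g)
  have hmem : ∀ t, ∀ g ∈ monics K n, σ t g ∈ monics K n := by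
    intro t g hg
    obtain ⟨hm, hd⟩ := mem_monics.mp hg
    have hlt : ((W t - 1) * g %ₘ (X * f)).degree < g.degree := by
      refine (degree_modByMonic_lt _ hFm).trans_le ?_
      rw [hFdeg, degree_eq_natDegree hm.ne_zero, hd]
      exact_mod_cast hn
    rw [hσ, mem_monics]
    exact ⟨hm.add_of_left hlt, by rw [natDegree_add_eq_left_of_degree_lt hlt, hd]⟩
  have hval : ∀ g ∈ monics K n, polyChar χ ψ a b c (σ u g) = χ u * polyChar χ ψ a b c g := by
    intro g hg
    have hd := (mem_monics.mp hg).2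
    have hd' := (mem_monics.mp (hmem u g hg)).2
    have hdvd : X * f ∣ σ u g - W u * g := by
      refine ⟨- ((W u - 1) * g /ₘ (X * f)), ?_⟩
      have := modByMonic_add_div ((W u - 1) * g) (X * f)
      rw [hσ]
      linear_combination this
    have he : (σ u g).eval 0 = u * g.eval 0 := by
      obtain ⟨s, hs⟩ := hdvd
      have h0 : (W u).eval 0 = u := by
        rw [hW, hf]; simp; field_simp; ring
      have := congrArg (eval 0) hs
      simp only [eval_sub, eval_mul, eval_X, zero_mul, h0] at this
      linear_combination this
    have hres : resTwo p r (σ u g) = resTwo p r g := by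
      have h1 : resTwo p r (W u) = 1 := by
        rw [resTwo_eq_of_dvd_sub (h := 1), map_one]
        exact ⟨C ((u - 1) / r), by rw [hW, hf]; ring⟩
      rw [resTwo_eq_of_dvd_sub (h := W u * g), map_mul, h1, one_mul]
      rw [← hf]
      exact (dvd_mul_left f X).trans hdvd
    rw [polyChar_apply, polyChar_apply, hd, hd', he, ← hp, ← hr, hres, map_mul]
    ring
  have hsum : ∑ g ∈ monics K n, polyChar χ ψ a b c g =
      χ u * ∑ g ∈ monics K n, polyChar χ ψ a b c g := by
    rw [Finset.mul_sum]
    symm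
    refine Finset.sum_bij' (fun g _ => σ u g) (fun g _ => σ (u⁻¹ : Kˣ) g) (hmem _) (hmem _) ?_ ?_ ?_
    · intro g _; exact hinv _ _ (by simp) g
    · intro g _; exact hinv _ _ (by simp) g
    · intro g hg; exact (hval g hg).symm
  have : (1 - χ u) * ∑ g ∈ monics K n, polyChar χ ψ a b c g = 0 := by linear_combination hsum
  exact (mul_eq_zero.mp this).resolve_left (sub_ne_zero.mpr hu.symm)

end

theorem monics_zero {K : Type*} [Field K] [Finite K] : monics K 0 = {1} := by
  ext g
  rw [mem_monics, Finset.mem_singleton]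
  exact ⟨fun h => h.1.natDegree_eq_zero.mp h.2, by rintro rfl; simp⟩

theorem sum_norm_eq_sum_monics {K L : Type*} [Field K] [Fintype K] [Field L] [Fintype L]
    [Algebra K L] (χ ψ : MulChar K ℂ) {a : K} (ha : a ≠ 0) (b c : K) :
    ∑ x : L, χ (Algebra.norm K x) * ψ (Algebra.norm K (aeval x (C a * X ^ 2 + C b * X + C c))) =
      ∑ d ∈ (Module.finrank K L).divisors, ∑ P ∈ (monics K d).filter Irreducible,
        (d : ℂ) * polyChar χ ψ a b c P ^ (Module.finrank K L / d) := by
  rw [← sum_map_minpoly _ rfl]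
  exact Finset.sum_congr rfl fun x _ => (polyChar_minpoly_pow χ ψ ha b c x).symm

/-- The rationality of the `L`-function of `polyChar`. -/
theorem exists_sum_monics_eq_power_sum {K : Type*} [Field K] [Fintype K] {χ : MulChar K ℂ}
    (hχ : χ ≠ 1) (ψ : MulChar K ℂ) {a : K} (ha : a ≠ 0) (b : K) {c : K} (hc : c ≠ 0) :
    ∃ α β : ℂ, ∀ n : ℕ, ∑ d ∈ (n + 1).divisors, ∑ P ∈ (monics K d).filter Irreducible,
      (d : ℂ) * polyChar χ ψ a b c P ^ ((n + 1) / d) = -(α ^ (n + 1) + β ^ (n + 1)) := by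
  obtain ⟨S, hS⟩ : ∃ S : ℕ → ℂ, ∀ n, S n = ∑ d ∈ n.divisors, ∑ P ∈ (monics K d).filter Irreducible,
      (d : ℂ) * polyChar χ ψ a b c P ^ (n / d) := ⟨_, fun _ => rfl⟩
  obtain ⟨A, hA⟩ : ∃ A : ℕ → ℂ, ∀ n, A n = ∑ g ∈ monics K n, polyChar χ ψ a b c g :=
    ⟨_, fun _ => rfl⟩
  have hnewton : ∀ n : ℕ, (n : ℂ) * A n = ∑ j ∈ Finset.Icc 1 n, S j * A (n - j) := by
    intro n
    simp only [hS, hA]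
    exact newton_monics _ n
  have hA0 : A 0 = 1 := by rw [hA, monics_zero, Finset.sum_singleton, map_one]
  have hA3 : ∀ n, 3 ≤ n → A n = 0 := fun n hn => by
    rw [hA]; exact sum_monics_eq_zero hχ ψ a b (div_ne_zero hc ha) hn
  obtain ⟨α, β, h⟩ := exists_power_sums (S := S) (A := A 1) (B := A 2)
    (by have := hnewton 1
        simp [hA0] at this
        exact this.symm)
    (by have := hnewton 2
        rw [Finset.sum_Icc_succ_top (by norm_num)] at this
        simp [hA0] at this
        linear_combination -this)
    (fun n => by
        have := hnewton (n + 3)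
        rw [hA3 _ (by omega), Finset.sum_Icc_succ_top (by omega),
          Finset.sum_Icc_succ_top (by omega),
          Finset.sum_Icc_succ_top (by omega), Finset.sum_eq_zero] at this
        · simp [hA0, show n + 3 - (n + 1) = 2 by omega, show n + 3 - (n + 2) = 1 by omega] at this
          linear_combination -this
        · intro j hj
          rw [Finset.mem_Icc] at hj
          rw [hA3 _ (by omega), mul_zero])
  exact ⟨α, β, fun n => by rw [← hS, h]⟩

theorem exists_root_derivative_ne_zero {K : Type*} [Field K] {a b c : K} (ha : a ≠ 0) (hc : c ≠ 0)
    (hdisc : b ^ 2 - 4 * a * c ≠ 0) : ∃ θ : AlgebraicClosure K, θ ≠ 0 ∧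
      aeval θ (C a * X ^ 2 + C b * X + C c) = 0 ∧
      aeval θ (derivative (C a * X ^ 2 + C b * X + C c)) ≠ 0 := by
  have inj := (algebraMap K (AlgebraicClosure K)).injective
  obtain ⟨θ, hθ⟩ := IsAlgClosed.exists_aeval_eq_zero (AlgebraicClosure K)
    (C a * X ^ 2 + C b * X + C c) (by rw [degree_quadratic ha]; decide)
  have hθ' := hθ
  simp only [map_add, map_mul, map_pow, aeval_C, aeval_X] at hθ'
  refine ⟨θ, ?_, hθ, fun h => hdisc (inj ?_)⟩
  · rintro rfl
    simp at hθ'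
    exact hc hθ'
  · simp at h
    simp only [map_sub, map_mul, map_pow, map_zero, map_ofNat]
    linear_combination (-4 * algebraMap K (AlgebraicClosure K) a) * hθ' +
      (2 * algebraMap K (AlgebraicClosure K) a * θ + algebraMap K (AlgebraicClosure K) b) * h

theorem weil_of_ne_one_of_ne_zero {K : Type*} [Field K] [Fintype K] (hK : 2 < Fintype.card K)
    {χ : MulChar K ℂ} (hχ : χ ≠ 1) (ψ : MulChar K ℂ) {a b c : K} (ha : a ≠ 0) (hc : c ≠ 0)
    (hdisc : b ^ 2 - 4 * a * c ≠ 0) :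
    ‖∑ x : K, χ x * ψ (a * x ^ 2 + b * x + c)‖ ≤ 2 * √(Fintype.card K) := by
  obtain ⟨α, β, h⟩ := exists_sum_monics_eq_power_sum hχ ψ ha b hc
  obtain ⟨θ, hθ, hfθ, hf'θ⟩ := exists_root_derivative_ne_zero ha hc hdisc
  have h1 : ∑ x : K, χ x * ψ (a * x ^ 2 + b * x + c) = -(α + β) := by
    have h2 := sum_norm_eq_sum_monics (L := K) χ ψ ha b c
    have h3 := h 0
    rw [Module.finrank_self] at h2
    rw [zero_add, pow_one, pow_one] at h3
    rw [← h3, ← h2]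
    refine Finset.sum_congr rfl fun x _ => ?_
    simp [Algebra.norm_self]
  rw [h1, norm_neg]
  have hq : (0 : ℝ) < Fintype.card K := by exact_mod_cast Fintype.card_pos
  refine norm_add_le_of_norm_pow_add_pow_le hq (C := 207 * (Fintype.card K - 1 : ℝ) ^ 2) fun m => ?_
  obtain ⟨p, hp⟩ := CharP.exists K
  have : Fact p.Prime := ⟨CharP.char_is_prime K p⟩
  have : Fintype (FiniteField.Extension K p (2 * (m + 2))) := Fintype.ofFinite _
  have hfr := FiniteField.finrank_extension K p (2 * (m + 2))
  have h4 := sum_norm_eq_sum_monics (L := FiniteField.Extension K p (2 * (m + 2))) χ ψ ha b c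
  have h5 := h4.trans ((by rw [hfr]; rfl : _ = _).trans (h (2 * m + 3)))
  rw [← norm_neg, show 2 * (m + 2) = 2 * m + 3 + 1 by ring, ← h5]
  exact norm_sum_norm_le hK natDegree_quadratic_le hθ hfθ hf'θ hfr (Or.inl hχ)

theorem norm_jacobiSum_le {K : Type*} [Field K] [Fintype K] {χ ψ : MulChar K ℂ}
    (h : χ ≠ 1 ∨ ψ ≠ 1) : ‖jacobiSum χ ψ‖ ≤ √(Fintype.card K) := by
  have hq : 1 ≤ √(Fintype.card K : ℝ) :=
    Real.one_le_sqrt.mpr (by exact_mod_cast Fintype.card_pos (α := K))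
  by_cases hχ : χ = 1
  · rw [hχ, jacobiSum_one_nontrivial (h.resolve_left (not_not.mpr hχ))]
    simpa using hq
  by_cases hψ : ψ = 1
  · rw [hψ, jacobiSum_comm, jacobiSum_one_nontrivial hχ]
    simpa using hq
  by_cases hχψ : χ * ψ = 1
  · rw [eq_inv_of_mul_eq_one_right hχψ, jacobiSum_nontrivial_inv hχ, norm_neg]
    exact (MulChar.norm_apply_le_one χ _).trans hq
  have hchar : ringChar ℂ ≠ ringChar K := by
    rw [ringChar.eq_zero]
    exact (CharP.ringChar_ne_zero_of_finite K).symm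
  have h1 := jacobiSum_mul_jacobiSum_inv hchar hχ hψ hχψ
  have h2 : jacobiSum χ⁻¹ ψ⁻¹ = star (jacobiSum χ ψ) := by
    simp only [jacobiSum, star_sum, star_mul', MulChar.star_apply']
  rw [h2, RCLike.star_def, Complex.mul_conj] at h1
  have h3 : Complex.normSq (jacobiSum χ ψ) = Fintype.card K := by exact_mod_cast h1
  rw [Complex.normSq_eq_norm_sq] at h3
  rw [← h3, Real.sqrt_sq (norm_nonneg _)]

theorem norm_sum_mulChar_quadratic_le_sqrt {K : Type*} [Field K] [Fintype K] {χ ψ : MulChar K ℂ}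
    (h : χ ≠ 1 ∨ ψ ≠ 1) {a b : K} (ha : a ≠ 0) (hb : b ≠ 0) :
    ‖∑ x : K, χ x * ψ (a * x ^ 2 + b * x)‖ ≤ √(Fintype.card K) := by
  have hab : -(b / a) ≠ 0 := neg_ne_zero.mpr (div_ne_zero hb ha)
  have h1 : ∑ x : K, χ x * ψ (a * x ^ 2 + b * x) =
      ((χ * ψ) (-(b / a)) * ψ b) * jacobiSum (χ * ψ) ψ := by
    rw [jacobiSum, Finset.mul_sum, ← Equiv.sum_comp (Equiv.mulLeft₀ (-(b / a)) hab)]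
    refine Finset.sum_congr rfl fun y _ => ?_
    rw [Equiv.mulLeft₀_apply, show a * (-(b / a) * y) ^ 2 + b * (-(b / a) * y) =
      -(b / a) * y * (b * (1 - y)) by field_simp; ring]
    simp only [map_mul, MulChar.mul_apply]
    ring
  have h2 : χ * ψ ≠ 1 ∨ ψ ≠ 1 := by
    by_contra! h3
    obtain ⟨h3, h4⟩ := h3
    rw [h4, mul_one] at h3
    simp [h3, h4] at h
  rw [h1, norm_mul, norm_mul]
  exact (mul_le_of_le_one_left (norm_nonneg _) (mul_le_one₀ (MulChar.norm_apply_le_one _ _)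
    (norm_nonneg _) (MulChar.norm_apply_le_one _ _))).trans (norm_jacobiSum_le h2)

theorem MulChar.eq_quadraticChar_of_sq_eq_one {K : Type*} [Field K] [Fintype K]
    {ψ : MulChar K ℂ} (hψ : ψ ≠ 1) (hψ2 : ψ ^ 2 = 1) :
    ringChar K ≠ 2 ∧ ∀ z, ψ z = (quadraticChar K z : ℂ) := by
  have hsq : ∀ y : K, y ≠ 0 → ψ (y ^ 2) = 1 := fun y hy => by
    rw [map_pow, ← MulChar.pow_apply' _ two_ne_zero, hψ2,
      MulChar.one_apply (isUnit_iff_ne_zero.mpr hy)]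
  obtain ⟨u, hu⟩ : ∃ u : Kˣ, ψ u ≠ 1 := by
    by_contra! h
    exact hψ (MulChar.ext fun u => by rw [h u, MulChar.one_apply_coe])
  have hnsq : ¬ IsSquare (u : K) := by
    rintro ⟨y, hy⟩
    rw [hy, ← pow_two, hsq] at hu
    · exact hu rfl
    · rintro rfl
      simp at hy
  refine ⟨fun h2 => hnsq (FiniteField.isSquare_of_char_two h2 _), fun z => ?_⟩
  have hu1 : ψ u = -1 := by
    have := hsq u u.ne_zero
    rw [map_pow, sq_eq_one_iff] at this
    exact this.resolve_left hu
  by_cases hz : z = 0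
  · simp [hz]
  rcases quadraticChar_dichotomy hz with h | h
  · obtain ⟨y, hy⟩ := (quadraticChar_one_iff_isSquare hz).mp h
    rw [h, hy, ← pow_two, hsq, Int.cast_one]
    rintro rfl
    simp at hy
    exact hz hy
  · obtain ⟨y, hy⟩ : IsSquare (u * z : K) := by
      rw [← quadraticChar_one_iff_isSquare (mul_ne_zero u.ne_zero hz), map_mul, h,
        quadraticChar_neg_one_iff_not_isSquare.mpr hnsq]
      rfl
    have h3 : ψ (u * z) = 1 := by
      rw [hy, ← pow_two, hsq]
      rintro rfl
      simp at hy
      exact hz hy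
    rw [map_mul, hu1] at h3
    rw [h, Int.cast_neg, Int.cast_one]
    linear_combination -h3

theorem norm_sum_quadratic_le_of_sq_eq_one {K : Type*} [Field K] [Fintype K]
    {ψ : MulChar K ℂ} (hψ : ψ ≠ 1) (hψ2 : ψ ^ 2 = 1) {a b c : K} (ha : a ≠ 0)
    (hdisc : b ^ 2 - 4 * a * c ≠ 0) :
    ‖∑ x : K, ψ (a * x ^ 2 + b * x + c)‖ ≤ √(Fintype.card K) := by
  obtain ⟨hchar, hquad⟩ := MulChar.eq_quadraticChar_of_sq_eq_one hψ hψ2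
  have h2 : (2 : K) ≠ 0 := Ring.two_ne_zero hchar
  have h4a : 4 * a ≠ 0 := mul_ne_zero
    (by rw [show (4 : K) = 2 * 2 by norm_num]; exact mul_ne_zero h2 h2) ha
  have h2a : 2 * a ≠ 0 := mul_ne_zero h2 ha
  obtain ⟨D, hD⟩ : ∃ D, D = b ^ 2 - 4 * a * c := ⟨_, rfl⟩
  rw [← hD] at hdisc
  have h1 : ψ (4 * a) * ∑ x : K, ψ (a * x ^ 2 + b * x + c) = ∑ y : K, ψ (y ^ 2 - D) := by
    rw [Finset.mul_sum]
    refine Fintype.sum_equiv ((Equiv.mulLeft₀ (2 * a) h2a).trans (Equiv.addRight b)) _ _ fun x => ?_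
    rw [← map_mul]
    congr 1
    simp only [Equiv.trans_apply, Equiv.mulLeft₀_apply, Equiv.coe_addRight, hD]
    ring
  have h3 : ∑ y : K, ψ (y ^ 2 - D) = ∑ z : K, (1 : MulChar K ℂ) z * ψ (1 * z ^ 2 + -D * z) := by
    rw [← Finset.sum_fiberwise_of_maps_to (g := fun y : K => y ^ 2) (t := Finset.univ) (by simp)]
    have h5 : ∀ z : K, ∑ y ∈ Finset.univ.filter (fun y : K => y ^ 2 = z), ψ (y ^ 2 - D) =
        ψ (z - D) + ψ z * ψ (z - D) := by
      intro z
      rw [Finset.sum_congr rfl (g := fun _ => ψ (z - D))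
        (fun y hy => by rw [(Finset.mem_filter.mp hy).2]), Finset.sum_const, nsmul_eq_mul]
      have h6 := quadraticChar_card_sqrts hchar z
      have h7 : ((Finset.univ.filter (fun y : K => y ^ 2 = z)).card : ℂ) = ψ z + 1 := by
        rw [hquad]
        have h8 : (Finset.univ.filter (fun y : K => y ^ 2 = z)) = {x : K | x ^ 2 = z}.toFinset := by
          ext; simp
        rw [h8]
        exact_mod_cast h6
      rw [h7]
      ring
    rw [Finset.sum_congr rfl fun z _ => h5 z, Finset.sum_add_distrib]
    have h9 : ∑ z : K, ψ (z - D) = 0 := by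
      rw [← MulChar.sum_eq_zero_of_ne_one hψ]
      exact Equiv.sum_comp (Equiv.subRight D) ψ
    rw [h9, zero_add]
    refine Finset.sum_congr rfl fun z _ => ?_
    by_cases hz : z = 0
    · simp [hz, MulChar.map_zero]
    · rw [MulChar.one_apply (isUnit_iff_ne_zero.mpr hz), one_mul, ← map_mul]
      congr 1
      ring
  have h5 := norm_sum_mulChar_quadratic_le_sqrt (χ := 1) (Or.inr hψ) one_ne_zero
    (neg_ne_zero.mpr hdisc)
  have h6 : ‖ψ (4 * a)‖ = 1 := by
    rw [hquad]
    rcases quadraticChar_dichotomy h4a with h | h <;> simp [h]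
  rwa [← h3, ← h1, norm_mul, h6, one_mul] at h5

theorem weil {K : Type*} [Field K] [Fintype K] (hK : 2 < Fintype.card K)
    {χ ψ : MulChar K ℂ} (h : χ ≠ 1 ∨ ψ ≠ 1) {a b c : K} (ha : a ≠ 0)
    (hdisc : b ^ 2 - 4 * a * c ≠ 0) :
    ‖∑ x : K, χ x * ψ (a * x ^ 2 + b * x + c)‖ ≤ 2 * √(Fintype.card K) := by
  have hq : 1 ≤ √(Fintype.card K : ℝ) :=
    Real.one_le_sqrt.mpr (by exact_mod_cast Fintype.card_pos (α := K))
  by_cases hc : c = 0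
  · have hb : b ≠ 0 := by
      rintro rfl
      simp [hc] at hdisc
    have := norm_sum_mulChar_quadratic_le_sqrt h ha hb
    simp only [hc, add_zero]
    linarith
  by_cases hχ : χ = 1
  swap
  · exact weil_of_ne_one_of_ne_zero hK hχ ψ ha hc hdisc
  have hψ := h.resolve_left (not_not.mpr hχ)
  by_cases hψ2 : ψ ^ 2 = 1
  · have h1 : ∑ x : K, χ x * ψ (a * x ^ 2 + b * x + c) =
        ∑ x : K, ψ (a * x ^ 2 + b * x + c) - ψ c := by
      rw [← Finset.add_sum_erase _ _ (Finset.mem_univ (0 : K)),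
        ← Finset.add_sum_erase Finset.univ (fun x : K => ψ (a * x ^ 2 + b * x + c))
          (Finset.mem_univ (0 : K))]
      rw [Finset.sum_congr rfl fun x hx => by
        rw [hχ, MulChar.one_apply (isUnit_iff_ne_zero.mpr (Finset.ne_of_mem_erase hx)), one_mul]]
      simp [MulChar.map_zero]
    have h2 := norm_sum_quadratic_le_of_sq_eq_one hψ hψ2 ha hdisc
    have h3 := norm_sub_le (∑ x : K, ψ (a * x ^ 2 + b * x + c)) (ψ c)
    have h4 := MulChar.norm_apply_le_one ψ c
    rw [h1]
    linarith
  · have h1 : ∑ x : K, χ x * ψ (a * x ^ 2 + b * x + c) =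
        ∑ x : K, (ψ ^ 2)⁻¹ x * ψ (c * x ^ 2 + b * x + a) := by
      rw [← Equiv.sum_comp (Equiv.inv K)]
      refine Finset.sum_congr rfl fun x _ => ?_
      by_cases hx : x = 0
      · simp [hx, MulChar.map_zero]
      rw [Equiv.inv_apply, hχ, MulChar.one_apply (isUnit_iff_ne_zero.mpr (inv_ne_zero hx)), one_mul,
        MulChar.inv_apply', MulChar.pow_apply' _ two_ne_zero, ← map_pow, ← map_mul]
      congr 1
      field_simp
      ring
    rw [h1]
    exact weil_of_ne_one_of_ne_zero hK (inv_ne_one.mpr hψ2) ψ hc ha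
      (by rwa [mul_right_comm] at hdisc)

/-- Vanishes at the nonzero `p`-th powers when `χ` has order `p`. -/
noncomputable def powerSieve {K : Type*} [Field K] (χ : MulChar K ℂ) (p : ℕ) (x : K) : ℂ :=
  1 - ((p : ℂ) - 1)⁻¹ * ∑ i ∈ Finset.Ico 1 p, (χ ^ i) x

theorem powerSieve_pow {K : Type*} [Field K] {χ : MulChar K ℂ} {p : ℕ} (hp : 1 < p)
    (hχ : χ ^ p = 1) {y : K} (hy : y ≠ 0) : powerSieve χ p (y ^ p) = 0 := by
  have h1 : ∀ i ∈ Finset.Ico 1 p, (χ ^ i) (y ^ p) = 1 := fun i _ => by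
    rw [map_pow, ← MulChar.pow_apply' _ (by lia), ← pow_mul, mul_comm, pow_mul, hχ, one_pow,
      MulChar.one_apply (isUnit_iff_ne_zero.mpr hy)]
  have hp1 : (p : ℂ) - 1 ≠ 0 := sub_ne_zero.mpr (by exact_mod_cast hp.ne')
  rw [powerSieve, Finset.sum_congr rfl h1, Finset.sum_const, Nat.card_Ico, nsmul_one,
    Nat.cast_sub hp.le, Nat.cast_one, inv_mul_cancel₀ hp1, sub_self]

theorem sum_prod_powerSieve_insert {K : Type*} [Field K] [Fintype K] (χ : ℕ → MulChar K ℂ)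
    (h : K → ℂ) {T : Finset ℕ} {p : ℕ} (hp : p ∉ T) (φ : MulChar K ℂ) :
    ∑ x, φ x * (∏ r ∈ insert p T, powerSieve (χ r) r x) * h x =
      ∑ x, φ x * (∏ r ∈ T, powerSieve (χ r) r x) * h x - ((p : ℂ) - 1)⁻¹ *
        ∑ i ∈ Finset.Ico 1 p, ∑ x, (φ * χ p ^ i) x * (∏ r ∈ T, powerSieve (χ r) r x) * h x := by
  rw [Finset.sum_comm, Finset.mul_sum, ← Finset.sum_sub_distrib]
  refine Finset.sum_congr rfl fun x _ => ?_
  rw [Finset.prod_insert hp, powerSieve]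
  simp only [MulChar.mul_apply]
  rw [← Finset.sum_mul, ← Finset.sum_mul, ← Finset.mul_sum]
  ring

theorem norm_inv_mul_sum_le {p : ℕ} (hp : 1 < p) {s : ℕ → ℂ} {B : ℝ}
    (hs : ∀ i ∈ Finset.Ico 1 p, ‖s i‖ ≤ B) :
    ‖((p : ℂ) - 1)⁻¹ * ∑ i ∈ Finset.Ico 1 p, s i‖ ≤ B := by
  have hp1 : (0 : ℝ) < p - 1 := sub_pos.mpr (by exact_mod_cast hp)
  have h1 := norm_sum_le_of_le _ hs
  rw [Finset.sum_const, Nat.card_Ico, nsmul_eq_mul, Nat.cast_sub hp.le, Nat.cast_one] at h1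
  have h2 : ‖(p : ℂ) - 1‖ = p - 1 := by
    rw [← Complex.ofReal_natCast, ← Complex.ofReal_one, ← Complex.ofReal_sub, Complex.norm_real,
      Real.norm_of_nonneg hp1.le]
  rw [norm_mul, norm_inv, h2]
  rwa [inv_mul_le_iff₀ hp1]

theorem norm_sum_prod_powerSieve_le {K : Type*} [Field K] [Fintype K] (χ : ℕ → MulChar K ℂ)
    {h : K → ℂ} {B : ℝ} (hB : ∀ φ : MulChar K ℂ, φ ≠ 1 → ‖∑ x, φ x * h x‖ ≤ B) (T : Finset ℕ)
    (hT : ∀ p ∈ T, p.Prime ∧ orderOf (χ p) = p) :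
    (∀ φ : MulChar K ℂ, φ ^ (∏ p ∈ T, p) ≠ 1 →
      ‖∑ x, φ x * (∏ p ∈ T, powerSieve (χ p) p x) * h x‖ ≤ 2 ^ T.card * B) ∧
    ‖∑ x, (1 : MulChar K ℂ) x * (∏ p ∈ T, powerSieve (χ p) p x) * h x -
      ∑ x, (1 : MulChar K ℂ) x * h x‖ ≤ (2 ^ T.card - 1) * B := by
  induction T using Finset.induction_on with
  | empty => simpa using hB
  | insert p T hp ih =>
    obtain ⟨ih1, ih2⟩ := ih fun r hr => hT r (Finset.mem_insert_of_mem hr)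
    obtain ⟨hpp, hord⟩ := hT p (Finset.mem_insert_self _ _)
    have hχp : χ p ^ p = 1 := orderOf_dvd_iff_pow_eq_one.mp hord.dvd
    rw [Finset.card_insert_of_notMem hp, Finset.prod_insert hp, pow_succ]
    constructor
    · intro φ hφ
      rw [sum_prod_powerSieve_insert χ h hp]
      have h1 := ih1 φ fun h1 => hφ (by rw [mul_comm, pow_mul, h1, one_pow])
      have h2 := norm_inv_mul_sum_le hpp.one_lt (B := 2 ^ T.card * B)
        (s := fun i => ∑ x, (φ * χ p ^ i) x * (∏ r ∈ T, powerSieve (χ r) r x) * h x)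
        fun i _ => ih1 _ fun h1 => hφ (by
          have h2 := congrArg (· ^ p) h1
          simp only [one_pow, mul_pow] at h2
          rwa [← pow_mul, ← pow_mul, ← pow_mul, mul_comm _ p, mul_left_comm, pow_mul (χ p), hχp,
            one_pow, mul_one] at h2)
      linarith [norm_sub_le_of_le h1 h2]
    · rw [sum_prod_powerSieve_insert χ h hp, sub_right_comm]
      have h2 := norm_inv_mul_sum_le hpp.one_lt (B := 2 ^ T.card * B)
        (s := fun i => ∑ x, ((1 : MulChar K ℂ) * χ p ^ i) x *
          (∏ r ∈ T, powerSieve (χ r) r x) * h x)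
        fun i hi => ih1 _ fun h1 => by
          rw [Finset.mem_Ico] at hi
          rw [one_mul, ← pow_mul, ← orderOf_dvd_iff_pow_eq_one, hord, hpp.dvd_mul,
            Prime.dvd_finsetProd_iff hpp.prime] at h1
          rcases h1 with h1 | ⟨r, hr, h1⟩
          · exact absurd (Nat.le_of_dvd (by lia) h1) (by lia)
          · rw [Nat.prime_dvd_prime_iff_eq hpp (hT r (Finset.mem_insert_of_mem hr)).1] at h1
            exact hp (h1 ▸ hr)
      linarith [norm_sub_le_of_le ih2 h2]

theorem exists_generator (K : Type*) [Field K] [Finite K] :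
    ∃ g : Kˣ, orderOf g = Nat.card K - 1 ∧ ∀ x : K, x ≠ 0 → ∃ j : ℕ, (g : K) ^ j = x := by
  obtain ⟨g, hg⟩ := IsCyclic.exists_monoid_generator (α := Kˣ)
  refine ⟨g, ?_, fun x hx => ?_⟩
  · rw [← Nat.card_units]
    exact orderOf_eq_card_of_forall_mem_powers hg
  · obtain ⟨j, hj⟩ := Submonoid.mem_powers_iff _ _ |>.mp (hg (Units.mk0 x hx))
    exact ⟨j, by rw [← Units.val_pow_eq_pow_val, hj, Units.val_mk0]⟩

theorem exists_pow_eq_of_mulChar_apply_eq_one {K : Type*} [Field K] [Finite K] {ψ : MulChar K ℂ}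
    {k : ℕ} (hψ : orderOf ψ = k) {z : K} (hz : ψ z = 1) : ∃ y : K, y ≠ 0 ∧ y ^ k = z := by
  obtain ⟨g, -, hg⟩ := exists_generator K
  have hz0 : z ≠ 0 := by
    rintro rfl
    simp [MulChar.map_zero] at hz
  obtain ⟨j, rfl⟩ := hg z hz0
  have h1 : ψ ^ j = 1 := by
    refine MulChar.ext fun u => ?_
    obtain ⟨i, hi⟩ := hg u u.ne_zero
    rw [MulChar.one_apply_coe, MulChar.pow_apply_coe, ← hi, ← map_pow, ← pow_mul, mul_comm, pow_mul,
      map_pow, hz, one_pow]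
  obtain ⟨i, rfl⟩ := hψ ▸ orderOf_dvd_iff_pow_eq_one.mpr h1
  exact ⟨(g : K) ^ i, pow_ne_zero _ g.ne_zero, by rw [← pow_mul, mul_comm]⟩

theorem exists_pow_eq_of_forall_not_prime_power {K : Type*} [Field K] [Finite K] {x : K}
    (hx : x ≠ 0) (h : ∀ p : ℕ, p.Prime → p ∣ Nat.card K - 1 → ∀ y : K, y ^ p ≠ x) (y : K)
    (hy : y ≠ 0) : ∃ n : ℕ, x ^ n = y := by
  obtain ⟨g, hgo, hg⟩ := exists_generator K
  obtain ⟨j, rfl⟩ := hg x hx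
  have hn : 0 < Nat.card K - 1 := Nat.sub_pos_of_lt Finite.one_lt_card
  have hcop : (orderOf g).Coprime j := by
    by_contra hc
    obtain ⟨p, hp, h1, i, rfl⟩ := Nat.Prime.not_coprime_iff_dvd.mp hc
    exact h p hp (hgo ▸ h1) ((g : K) ^ i) (by rw [← pow_mul, mul_comm])
  obtain ⟨m, hm⟩ := exists_pow_eq_self_of_coprime hcop.symm
  obtain ⟨i, rfl⟩ := hg y hy
  refine ⟨m * i, ?_⟩
  rw [pow_mul, ← Units.val_pow_eq_pow_val, ← Units.val_pow_eq_pow_val, hm]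

theorem sum_pow_apply_eq_zero {K : Type*} [Field K] [Finite K] {ψ : MulChar K ℂ} {k : ℕ}
    (hψ : orderOf ψ = k) {z : K} (hz : ¬ ∃ y : K, y ≠ 0 ∧ y ^ k = z) :
    ∑ i ∈ Finset.range k, (ψ ^ i) z = 0 := by
  by_cases hz0 : z = 0
  · simp [hz0, MulChar.map_zero]
  obtain ⟨u, rfl⟩ : ∃ u : Kˣ, (u : K) = z := ⟨Units.mk0 z hz0, rfl⟩
  have h1 : ψ u ≠ 1 := fun h1 => hz (exists_pow_eq_of_mulChar_apply_eq_one hψ h1)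
  have h2 : ψ u ^ k = 1 := by
    rw [← MulChar.pow_apply_coe, ← hψ, pow_orderOf_eq_one, MulChar.one_apply_coe]
  simp only [MulChar.pow_apply_coe]
  rw [geom_sum_eq h1, h2, sub_self, zero_div]

theorem exists_mulChar_complex_orderOf (K : Type*) [Field K] [Fintype K] {n : ℕ}
    (hn : n ∣ Fintype.card K - 1) : ∃ χ : MulChar K ℂ, orderOf χ = n := by
  have hn0 : n ≠ 0 := by
    rintro rfl
    have := Fintype.one_lt_card (α := K)
    have := Nat.eq_zero_of_zero_dvd hn
    lia
  exact MulChar.exists_mulChar_orderOf K hn (Complex.isPrimitiveRoot_exp n hn0)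

theorem le_norm_sum_mulChar_one {K : Type*} [Field K] [Fintype K] {a b c : K} (ha : a ≠ 0) :
    (Fintype.card K : ℝ) - 3 ≤
      ‖∑ x : K, (1 : MulChar K ℂ) x * (1 : MulChar K ℂ) (a * x ^ 2 + b * x + c)‖ := by
  have hf : C a * X ^ 2 + C b * X + C c ≠ 0 := fun h => by
    have := natDegree_quadratic (b := b) (c := c) ha
    rw [h] at this
    simp at this
  obtain ⟨g, hg⟩ : ∃ g : K[X], g = X * (C a * X ^ 2 + C b * X + C c) := ⟨_, rfl⟩
  have h0 := card_roots_filter_le (hg ▸ mul_ne_zero X_ne_zero hf)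
  rw [show g.natDegree = 3 by
    rw [hg, natDegree_X_mul hf, natDegree_quadratic ha]] at h0
  have h1 : ∀ x : K, (1 : MulChar K ℂ) x * (1 : MulChar K ℂ) (a * x ^ 2 + b * x + c) =
      1 - if eval x g = 0 then 1 else 0 := by
    intro x
    have : eval x g = x * (a * x ^ 2 + b * x + c) := by simp [hg]
    rw [← map_mul, ← this]
    split_ifs with h
    · simp [h, MulChar.map_zero]
    · rw [MulChar.one_apply (isUnit_iff_ne_zero.mpr h), sub_zero]
  have h2 : (Fintype.card K : ℝ) - 3 ≤
      ((Fintype.card K : ℝ) - ((Finset.univ.filter fun x => eval x g = 0).card : ℕ)) := by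
    have : ((Finset.univ.filter fun x => eval x g = 0).card : ℝ) ≤ 3 := by exact_mod_cast h0
    linarith
  rw [Finset.sum_congr rfl fun x _ => h1 x, Finset.sum_sub_distrib, Finset.sum_boole,
    Finset.sum_const, nsmul_one, Finset.card_univ]
  refine h2.trans ((le_abs_self _).trans_eq ?_)
  rw [← Real.norm_eq_abs, ← Complex.norm_real]
  simp

theorem exists_primitive_of_le_sqrt {K : Type*} [Field K] [Fintype K] {k : ℕ}
    (hK : 9 ≤ Fintype.card K) (hk : k ∣ Fintype.card K - 1) {a b c : K} (ha : a ≠ 0)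
    (hdisc : b ^ 2 - 4 * a * c ≠ 0)
    (hle : 2 * (k : ℝ) * 2 ^ (Fintype.card K - 1).primeFactors.card ≤ √(Fintype.card K)) :
    ∃ g : K, (∀ y : K, y ≠ 0 → ∃ n : ℕ, g ^ n = y) ∧
      ∃ y : K, y ≠ 0 ∧ y ^ k = a * g ^ 2 + b * g + c := by
  obtain ⟨ψ, hψ⟩ := exists_mulChar_complex_orderOf K hk
  have hT : ∀ p : ℕ, ∃ χ : MulChar K ℂ, p ∣ Fintype.card K - 1 → orderOf χ = p := fun p => by
    by_cases hp : p ∣ Fintype.card K - 1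
    · obtain ⟨χ, hχ⟩ := exists_mulChar_complex_orderOf K hp
      exact ⟨χ, fun _ => hχ⟩
    · exact ⟨1, fun h => absurd h hp⟩
  choose χ hχ using hT
  obtain ⟨T, hTdef⟩ : ∃ T, T = (Fintype.card K - 1).primeFactors := ⟨_, rfl⟩
  rw [← hTdef] at hle
  have hk0 : 0 < k := Nat.pos_of_dvd_of_pos hk (by lia)
  have hq9 : (9 : ℝ) ≤ Fintype.card K := by exact_mod_cast hK
  have hs3 : 3 ≤ √(Fintype.card K : ℝ) := Real.le_sqrt_of_sq_le (by linarith)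
  have hss : √(Fintype.card K : ℝ) * √(Fintype.card K : ℝ) = Fintype.card K :=
    Real.mul_self_sqrt (by linarith)
  obtain ⟨h, hh⟩ : ∃ h : K → ℂ, ∀ x, h x = ∑ i ∈ Finset.range k, (ψ ^ i) (a * x ^ 2 + b * x + c) :=
    ⟨_, fun _ => rfl⟩
  have hswap : ∀ φ : MulChar K ℂ, ∑ x, φ x * h x =
      ∑ i ∈ Finset.range k, ∑ x, φ x * (ψ ^ i) (a * x ^ 2 + b * x + c) := fun φ => by
    rw [Finset.sum_comm]
    exact Finset.sum_congr rfl fun x _ => by rw [hh, Finset.mul_sum]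
  have hB : ∀ φ : MulChar K ℂ, φ ≠ 1 → ‖∑ x, φ x * h x‖ ≤ k * (2 * √(Fintype.card K)) := by
    intro φ hφ
    rw [hswap]
    refine (norm_sum_le_of_le _ fun i _ => weil (by lia) (Or.inl hφ) ha hdisc).trans_eq ?_
    rw [Finset.sum_const, Finset.card_range, nsmul_eq_mul]
  have hM : (Fintype.card K : ℝ) - 3 - (k - 1) * (2 * √(Fintype.card K)) ≤
      ‖∑ x, (1 : MulChar K ℂ) x * h x‖ := by
    obtain ⟨m, rfl⟩ := Nat.exists_eq_add_of_lt hk0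
    rw [zero_add] at *
    rw [hswap, Finset.sum_range_succ']
    have h1 := norm_sum_le_of_le (Finset.range m) (f := fun i => ∑ x : K, (1 : MulChar K ℂ) x *
      (ψ ^ (i + 1)) (a * x ^ 2 + b * x + c)) (n := fun _ => 2 * √(Fintype.card K)) fun i hi => by
        refine weil (by lia) (Or.inr fun h1 => ?_) ha hdisc
        rw [← orderOf_dvd_iff_pow_eq_one, hψ] at h1
        exact absurd (Nat.le_of_dvd (by lia) h1) (by simpa using hi)
    rw [Finset.sum_const, Finset.card_range, nsmul_eq_mul] at h1
    have h2 := le_norm_sum_mulChar_one (b := b) (c := c) ha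
    have h3 := norm_sub_norm_le (∑ x : K, (1 : MulChar K ℂ) x * (ψ ^ 0) (a * x ^ 2 + b * x + c))
      (-∑ i ∈ Finset.range m, ∑ x : K, (1 : MulChar K ℂ) x *
        (ψ ^ (i + 1)) (a * x ^ 2 + b * x + c))
    rw [norm_neg, sub_neg_eq_add, add_comm (∑ x : K, _), pow_zero] at h3
    push_cast
    rw [pow_zero]
    linarith
  obtain ⟨-, hS⟩ := norm_sum_prod_powerSieve_le χ hB T fun p hp => by
    rw [hTdef] at hp
    exact ⟨Nat.prime_of_mem_primeFactors hp, hχ p (Nat.dvd_of_mem_primeFactors hp)⟩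
  have hne : ∑ x, (1 : MulChar K ℂ) x * (∏ p ∈ T, powerSieve (χ p) p x) * h x ≠ 0 := by
    intro h0
    rw [h0, zero_sub, norm_neg] at hS
    have := mul_le_mul_of_nonneg_right hle (Real.sqrt_nonneg (Fintype.card K))
    linarith
  obtain ⟨x, -, hx⟩ := Finset.exists_ne_zero_of_sum_ne_zero hne
  have hx0 : x ≠ 0 := by
    rintro rfl
    simp [MulChar.map_zero] at hx
  refine ⟨x, exists_pow_eq_of_forall_not_prime_power hx0 fun p hp hpd y hy => hx ?_, ?_⟩
  · rw [Nat.card_eq_fintype_card] at hpd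
    have hpT : p ∈ T := hTdef ▸ Nat.mem_primeFactors.mpr ⟨hp, hpd, by lia⟩
    have hy0 : y ≠ 0 := by
      rintro rfl
      exact hx0 (by rw [← hy, zero_pow hp.ne_zero])
    rw [Finset.prod_eq_zero hpT, mul_zero, zero_mul]
    rw [← hy]
    exact powerSieve_pow hp.one_lt (orderOf_dvd_iff_pow_eq_one.mp (hχ p hpd).dvd) hy0
  · by_contra hc
    exact hx (by rw [hh, sum_pow_apply_eq_zero hψ hc, mul_zero])

theorem eight_pow_card_primeFactors_le {n : ℕ} (hn : n ≠ 0) (h : 10 ≤ n.primeFactors.card) :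
    8 ^ n.primeFactors.card ≤ n := by
  obtain ⟨S, hS⟩ : ∃ S : Finset ℕ, S = {2, 3, 5, 7, 11, 13, 17, 19, 23, 29} := ⟨_, rfl⟩
  obtain ⟨U, hU⟩ : ∃ U, U = n.primeFactors.filter (· < 31) := ⟨_, rfl⟩
  obtain ⟨V, hV⟩ : ∃ V, V = n.primeFactors.filter (¬ · < 31) := ⟨_, rfl⟩
  have hScard : S.card = 10 := by rw [hS]; rfl
  have hSprod : 8 ^ 10 ≤ ∏ p ∈ S, p := by rw [hS]; decide
  have hUS : U ⊆ S := by
    intro p hp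
    rw [hU, Finset.mem_filter] at hp
    have hpp := Nat.prime_of_mem_primeFactors hp.1
    have := hp.2
    rw [hS]
    interval_cases p <;> first | decide | exact absurd hpp (by norm_num)
  have hcard : U.card + V.card = n.primeFactors.card := by
    rw [hU, hV]
    exact Finset.card_filter_add_card_filter_not _
  have hprod : (∏ p ∈ U, p) * ∏ p ∈ V, p ≤ n := by
    rw [hU, hV, Finset.prod_filter_mul_prod_filter_not]
    exact Nat.le_of_dvd (Nat.pos_of_ne_zero hn) (Nat.prod_primeFactors_dvd n)
  have hUcard : U.card ≤ 10 := hScard ▸ Finset.card_le_card hUS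
  have h1 : ∏ p ∈ S \ U, p ≤ 29 ^ (10 - U.card) := by
    rw [← hScard, ← Finset.card_sdiff_of_subset hUS]
    refine Finset.prod_le_pow_card _ _ _ fun p hp => ?_
    have := (Finset.mem_sdiff.mp hp).1
    rw [hS] at this
    simp only [Finset.mem_insert, Finset.mem_singleton] at this
    lia
  have h2 : 31 ^ V.card ≤ ∏ p ∈ V, p :=
    Finset.pow_card_le_prod _ _ _ fun p hp => by
      rw [hV, Finset.mem_filter] at hp
      lia
  have h3 := Finset.prod_sdiff (f := fun p : ℕ => p) hUS
  obtain ⟨d, hd⟩ := Nat.exists_eq_add_of_le h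
  rw [show V.card = d + (10 - U.card) by lia, pow_add] at h2
  rw [hd, pow_add]
  refine le_of_mul_le_mul_left ?_ (by positivity : 0 < 29 ^ (10 - U.card))
  calc 29 ^ (10 - U.card) * (8 ^ 10 * 8 ^ d)
      ≤ 31 ^ (10 - U.card) * ((∏ p ∈ S, p) * 31 ^ d) := by gcongr <;> norm_num
    _ = (∏ p ∈ S \ U, p) * ((∏ p ∈ U, p) * (31 ^ d * 31 ^ (10 - U.card))) := by rw [← h3]; ring
    _ ≤ 29 ^ (10 - U.card) * n := by
      gcongr
      exact (Nat.mul_le_mul_left _ h2).trans hprod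

theorem eight_pow_nine_le_exp_exp_three : (8 : ℝ) ^ 9 ≤ Real.exp (Real.exp 3) := by
  have h1 := Real.exp_one_gt_d9
  have h3 : (20 : ℝ) ≤ Real.exp 3 := by
    rw [show (3 : ℝ) = (3 : ℕ) * 1 by norm_num, Real.exp_nat_mul]
    calc (20 : ℝ) ≤ 2.7182818283 ^ 3 := by norm_num
      _ ≤ _ := by gcongr
  calc (8 : ℝ) ^ 9 ≤ 2.7182818283 ^ 20 := by norm_num
    _ ≤ Real.exp 1 ^ 20 := by gcongr
    _ = Real.exp 20 := by rw [← Real.exp_nat_mul]; norm_num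
    _ ≤ _ := Real.exp_le_exp.mpr h3

theorem mul_two_pow_card_primeFactors_le_sqrt {q k : ℕ} (hq : Real.exp (Real.exp 3) < q)
    (hk : (2 * k : ℝ) ^ 6 < q) : 2 * (k : ℝ) * 2 ^ (q - 1).primeFactors.card ≤ √q := by
  have h8 : (8 : ℝ) ^ 9 < q := eight_pow_nine_le_exp_exp_three.trans_lt hq
  have hq0 : q - 1 ≠ 0 := by
    have : 8 ^ 9 < q := by exact_mod_cast h8
    lia
  have hω : (8 : ℝ) ^ (q - 1).primeFactors.card ≤ q := by
    rcases le_or_gt (q - 1).primeFactors.card 9 with h | h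
    · exact (pow_le_pow_right₀ (by norm_num) h).trans h8.le
    · exact_mod_cast (eight_pow_card_primeFactors_le hq0 h).trans (Nat.sub_le _ _)
  refine Real.le_sqrt_of_sq_le (le_of_pow_le_pow_left₀ three_ne_zero (by positivity) ?_)
  calc ((2 * (k : ℝ) * 2 ^ (q - 1).primeFactors.card) ^ 2) ^ 3
      = (2 * k : ℝ) ^ 6 * ((8 : ℝ) ^ (q - 1).primeFactors.card) ^ 2 := by
        rw [show (8 : ℝ) = 2 ^ 3 by norm_num, ← pow_mul 2 3]; ring
    _ ≤ q * (q : ℝ) ^ 2 := by gcongr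
    _ = (q : ℝ) ^ 3 := by ring

theorem primitive_element_with_kth_power_value
    {F : Type*} [Field F] [Fintype F] {q k : ℕ} (hq : Fintype.card F = q)
    (hk : 2 ≤ k) (hkdvd : k ∣ q - 1)
    (a b c : F) (ha : a ≠ 0) (hdisc : b ^ 2 - 4 * a * c ≠ 0)
    (hqbig : max (Real.exp (Real.exp 3)) (((2 * k : ℕ) : ℝ) ^ 6) < (q : ℝ)) :
    ∃ g : F, IsPrimitiveElement g ∧ ∃ y : F, y ≠ 0 ∧ y ^ k = a * g ^ 2 + b * g + c := by
  subst hq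
  obtain ⟨hq1, hq2⟩ := max_lt_iff.mp hqbig
  rw [Nat.cast_mul, Nat.cast_ofNat] at hq2
  have hq9 : 9 ≤ Fintype.card F := by
    have : 8 ^ 9 < Fintype.card F := by
      exact_mod_cast eight_pow_nine_le_exp_exp_three.trans_lt hq1
    lia
  exact exists_primitive_of_le_sqrt hq9 hkdvd ha hdisc
    (mul_two_pow_card_primeFactors_le_sqrt hq1 hq2)
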